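/- arXiv:1606.07844 — 3 statements merged into one kernel-verified Lean document; each statement's English description precedes it below -/
import Mathlib

section
/- Let p > 3 be a prime and let h_p denote the class number of the imaginary quadratic field ℚ(√−p). Then ∑_{x=1}^{p−1} {−x²/p} = (p − 1)/2 if p ≡ 1 (mod 4), and ∑_{x=1}^{p−1} {−x²/p} = (p − 1)/2 + h_p if p ≡ 3 (mod 4). -/
section E
open Finset

noncomputable def chiSum (p : ℕ) [Fact p.Prime] : ℤ := ∑ a : ZMod p, quadraticChar (ZMod p) a * (a.val : ℤ)

lemma fract_eq_val (p : ℕ) [Fact p.Prime] (x : ℕ) :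
    Int.fract (-(x : ℚ) ^ 2 / (p : ℚ)) = ((-((x : ZMod p)) ^ 2).val : ℚ) / p := by
  have hp : (p:ℚ) ≠ 0 := by exact_mod_cast (Fact.out : p.Prime).ne_zero
  have h1 : (-(x : ℚ) ^ 2 / (p : ℚ)) = (((-(x:ℤ)^2 : ℤ)) : ℚ) / ((p:ℤ):ℚ) := by push_cast; ring
  have h2 : ((-((x : ZMod p)) ^ 2).val : ℤ) = (-(x:ℤ)^2) % p := by
    rw [← ZMod.val_intCast]; push_cast; rfl
  have h3 : ((-((x : ZMod p)) ^ 2).val : ℚ) = (((-(x:ℤ)^2) % (p:ℤ) : ℤ) : ℚ) := by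
    rw [← h2]; push_cast; rfl
  rw [h3, h1, Int.cast_natCast, Int.fract_div_intCast_eq_div_intCast_mod]

lemma sum_icc_eq (p : ℕ) [Fact p.Prime] :
    ∑ x ∈ Finset.Icc 1 (p - 1), Int.fract (-(x : ℚ) ^ 2 / (p : ℚ)) =
      ∑ a : ZMod p, ((-(a ^ 2)).val : ℚ) / p := by
  have hp := (Fact.out : p.Prime).pos
  rw [← Finset.sum_subset (s₁ := (Finset.univ : Finset (ZMod p)).erase 0) (erase_subset _ _)
    (by intro x _ hx; simp at hx; simp [hx])]
  refine Finset.sum_bij (fun x _ => (x : ZMod p)) ?_ ?_ ?_ ?_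
  · intro x hx
    simp only [mem_Icc] at hx
    simp only [mem_erase, mem_univ, and_true, ne_eq]
    rw [ZMod.natCast_eq_zero_iff]
    exact Nat.not_dvd_of_pos_of_lt (by omega) (by omega)
  · intro a ha b hb h
    simp only [mem_Icc] at ha hb
    have := congrArg ZMod.val h
    rwa [ZMod.val_natCast_of_lt (by omega), ZMod.val_natCast_of_lt (by omega)] at this
  · intro b hb
    simp only [mem_erase, mem_univ, and_true, ne_eq] at hb
    refine ⟨b.val, ?_, by simp⟩
    have h1 := b.val_lt
    have h2 : b.val ≠ 0 := by rwa [ne_eq, ZMod.val_eq_zero]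
    simp only [mem_Icc]; omega
  · intro x _
    exact fract_eq_val p x

lemma sum_sq_eq (p : ℕ) [Fact p.Prime] (hp : p ≠ 2) (f : ZMod p → ℤ) :
    ∑ a : ZMod p, f (-(a^2)) = ∑ b : ZMod p, (1 + quadraticChar (ZMod p) (-b)) * f b := by
  rw [← Finset.sum_fiberwise (g := fun a : ZMod p => -(a^2))]
  refine Finset.sum_congr rfl fun b _ => ?_
  rw [Finset.sum_congr rfl (g := fun _ => f b) (by intro x hx; simp at hx; rw [hx])]
  rw [Finset.sum_const, nsmul_eq_mul]
  congr 1
  rw [add_comm, ← quadraticChar_card_sqrts (by rwa [ZMod.ringChar_zmod_n])]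
  congr 2
  ext x
  simp [neg_eq_iff_eq_neg]

lemma sum_val (p : ℕ) [Fact p.Prime] : 2 * ∑ b : ZMod p, (b.val : ℤ) = p * (p - 1) := by
  obtain ⟨n, rfl⟩ : ∃ n, p = n + 1 := ⟨p - 1, by have := (Fact.out : p.Prime).pos; omega⟩
  have : ∑ b : ZMod (n+1), (b.val : ℤ) = ∑ i ∈ range (n+1), (i : ℤ) := by
    rw [Finset.sum_range]; rfl
  rw [this]
  have := Finset.sum_range_id_mul_two (n+1)
  zify at this
  rw [mul_comm]; push_cast at this ⊢; rw [this]; ring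

lemma quad_neg (p : ℕ) [Fact p.Prime] (b : ZMod p) :
    quadraticChar (ZMod p) (-b) = quadraticChar (ZMod p) (-1) * quadraticChar (ZMod p) b := by
  rw [← map_mul]; simp

lemma sum_main (p : ℕ) [Fact p.Prime] (hp : p ≠ 2) :
    ∑ x ∈ Finset.Icc 1 (p - 1), Int.fract (-(x : ℚ) ^ 2 / (p : ℚ)) =
      ((p : ℚ) - 1) / 2 + (quadraticChar (ZMod p) (-1) : ℤ) * (chiSum p : ℚ) / p := by
  have hp0 : (p:ℚ) ≠ 0 := by exact_mod_cast (Fact.out : p.Prime).ne_zero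
  rw [sum_icc_eq, ← Finset.sum_div]
  have h1 := sum_sq_eq p hp (fun a => (a.val : ℤ))
  have h2 : ∑ b : ZMod p, (1 + quadraticChar (ZMod p) (-b)) * (b.val : ℤ) =
     ∑ b : ZMod p, (b.val : ℤ) + quadraticChar (ZMod p) (-1) * chiSum p := by
    rw [chiSum, Finset.mul_sum, ← Finset.sum_add_distrib]
    refine Finset.sum_congr rfl fun b _ => ?_
    rw [quad_neg]; ring
  have h3 := sum_val p
  have h4 : ∑ a : ZMod p, ((-(a ^ 2)).val : ℚ) = ((∑ a : ZMod p, ((-(a ^ 2)).val : ℤ) : ℤ) : ℚ) := by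
    push_cast; rfl
  have h5 : (2:ℚ) * ((∑ b : ZMod p, (b.val : ℤ) : ℤ) : ℚ) = p * (p - 1) := by exact_mod_cast h3
  rw [h4, h1, h2]
  push_cast at h5 ⊢
  field_simp
  linear_combination h5

lemma chiSum_symm (p : ℕ) [Fact p.Prime] (hp : p ≠ 2) (h : p % 4 = 1) : chiSum p = 0 := by
  have hm : quadraticChar (ZMod p) (-1) = 1 := by
    rw [quadraticChar_neg_one (by rwa [ZMod.ringChar_zmod_n]), ZMod.card, ZMod.χ₄_nat_one_mod_four h]
  have h0 : ∑ a : ZMod p, quadraticChar (ZMod p) a = 0 :=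
    quadraticChar_sum_zero (by rwa [ZMod.ringChar_zmod_n])
  have h1 : chiSum p = ∑ a : ZMod p, quadraticChar (ZMod p) a * ((-a).val : ℤ) := by
    rw [chiSum, ← Equiv.sum_comp (Equiv.neg _)]
    refine Finset.sum_congr rfl fun b _ => ?_
    simp only [Equiv.neg_apply]
    rw [quad_neg, hm, one_mul]
  have h2 : chiSum p + chiSum p = 0 := by
    conv_lhs => enter [2]; rw [h1]
    rw [chiSum, ← Finset.sum_add_distrib]
    have : ∀ a : ZMod p, quadraticChar (ZMod p) a * (a.val : ℤ) + quadraticChar (ZMod p) a * ((-a).val : ℤ) = quadraticChar (ZMod p) a * p := by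
      intro a
      by_cases ha : a = 0
      · simp [ha]
      · have : NeZero a := ⟨ha⟩
        rw [ZMod.val_neg_of_ne_zero, Nat.cast_sub a.val_lt.le]; ring
    simp_rw [this]
    rw [← Finset.sum_mul, h0, zero_mul]
  omega

lemma quad_neg_one_three (p : ℕ) [Fact p.Prime] (hp : p ≠ 2) (h : p % 4 = 3) : quadraticChar (ZMod p) (-1) = -1 := by
    rw [quadraticChar_neg_one (by rwa [ZMod.ringChar_zmod_n]), ZMod.card, ZMod.χ₄_nat_three_mod_four h]

end E
section C1
open Complex HurwitzZeta Filter Topology Set MeasureTheory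

lemma one_sub_re_pos {z : ℂ} (hz : ‖z‖ = 1) (hz1 : z ≠ 1) {t : ℝ} (ht : 0 ≤ t) :
    0 < (1 - z * (Real.exp (-t) : ℂ)).re := by
  have h1 : z.re < 1 := by
    refine lt_of_le_of_ne (hz ▸ Complex.re_le_norm z) fun h => hz1 ?_
    have h2 : z.re ^ 2 + z.im ^ 2 = 1 := by
      have := Complex.sq_norm z
      rw [hz, Complex.normSq_apply] at this; nlinarith
    have h3 : z.im = 0 := by rw [h] at h2; nlinarith
    exact Complex.ext (by simpa using h) (by simpa using h3)
  have h4 : Real.exp (-t) ≤ 1 := Real.exp_le_one_iff.mpr (by linarith)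
  have h5 := Real.exp_pos (-t)
  rw [sub_re, one_re, re_mul_ofReal]
  by_cases h : 0 ≤ z.re <;> nlinarith

noncomputable def Fz (z : ℂ) (t : ℝ) : ℂ := z * (Real.exp (-t) : ℂ) / (1 - z * (Real.exp (-t) : ℂ))

lemma Fz_top {z : ℂ} (hz : ‖z‖ = 1) : Fz z =O[atTop] fun t => Real.exp (-1 * t) := by
  refine Asymptotics.IsBigO.of_bound 2 ?_
  filter_upwards [eventually_ge_atTop 1] with t ht
  have h0 : ‖z * (Real.exp (-t) : ℂ)‖ = Real.exp (-t) := by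
    rw [norm_mul, hz, one_mul, Complex.norm_real, Real.norm_of_nonneg (Real.exp_pos _).le]
  have h1 : Real.exp (-t) ≤ 1/2 := by
    have : Real.exp (-t) ≤ Real.exp (-1) := Real.exp_le_exp.mpr (by linarith)
    have h2 := Real.exp_neg_one_lt_d9
    linarith
  have h2 : 1/2 ≤ ‖1 - z * (Real.exp (-t) : ℂ)‖ := by
    have := norm_sub_norm_le (1:ℂ) (z * (Real.exp (-t) : ℂ))
    rw [h0, norm_one] at this; linarith
  rw [Fz, norm_div, h0, Real.norm_of_nonneg (Real.exp_pos _).le, neg_one_mul]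
  rw [div_le_iff₀ (by linarith)]
  nlinarith [Real.exp_pos (-t)]

lemma Fz_cont {z : ℂ} (hz : ‖z‖ = 1) (hz1 : z ≠ 1) {t : ℝ} (ht : 0 ≤ t) : ContinuousAt (Fz z) t := by
  unfold Fz
  refine ContinuousAt.div (by fun_prop) (by fun_prop) ?_
  intro h
  have := one_sub_re_pos hz hz1 ht
  rw [h] at this; simp at this

lemma Fz_loc {z : ℂ} (hzn : ‖z‖ = 1) (hz1 : z ≠ 1) : LocallyIntegrableOn (Fz z) (Ioi 0) := by
  refine ContinuousOn.locallyIntegrableOn ?_ measurableSet_Ioi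
  intro t ht
  exact (Fz_cont hzn hz1 (le_of_lt ht)).continuousWithinAt

lemma Fz_bot {z : ℂ} (hzn : ‖z‖ = 1) (hz1 : z ≠ 1) : Fz z =O[𝓝[>] 0] fun t : ℝ => t ^ (-(0:ℝ)) := by
  have h := (Fz_cont hzn hz1 le_rfl).tendsto.isBigO_one ℝ
  simpa using h.mono nhdsWithin_le_nhds

lemma Fz_mellin {z : ℂ} (hz : ‖z‖ = 1) (hz1 : z ≠ 1) : mellin (Fz z) 1 = - Complex.log (1 - z) := by
  have h1 : mellin (Fz z) 1 = ∫ t in Ioi (0:ℝ), Fz z t := by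
    simp [mellin]
  rw [h1]
  have h2 : ∀ t ∈ Ici (0:ℝ), HasDerivAt (fun t : ℝ => Complex.log (1 - z * (Real.exp (-t) : ℂ))) (Fz z t) t := by
    intro t ht
    have hs : (1 - z * (Real.exp (-t) : ℂ)) ∈ slitPlane := Or.inl (one_sub_re_pos hz hz1 ht)
    have h3 : HasDerivAt (fun t : ℝ => 1 - z * (Real.exp (-t) : ℂ)) (z * (Real.exp (-t) : ℂ)) t := by
      have h4 : HasDerivAt (fun t : ℝ => Real.exp (-t)) (-Real.exp (-t)) t := by
        simpa using (hasDerivAt_neg t).exp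
      have := (h4.ofReal_comp.const_mul z).const_sub 1
      simpa using this
    exact h3.clog_real hs
  have hInt : IntegrableOn (Fz z) (Ioi 0) := by
    have := mellinConvergent_of_isBigO_rpow_exp (b := 0) (s := 1) one_pos (Fz_loc hz hz1) (Fz_top hz)
      (Fz_bot hz hz1) (by simp)
    simpa [MellinConvergent] using this
  have h5 := integral_Ioi_of_hasDerivAt_of_tendsto' (m := 0) h2
    hInt ?_
  · rw [h5]; simp
  · have h6 : Tendsto (fun t : ℝ => 1 - z * (Real.exp (-t) : ℂ)) atTop (𝓝 1) := by
      have h7 : Tendsto (fun t : ℝ => (Real.exp (-t) : ℂ)) atTop (𝓝 ((0:ℝ) : ℂ)) :=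
        (Complex.continuous_ofReal.tendsto _).comp (Real.tendsto_exp_atBot.comp tendsto_neg_atTop_atBot)
      simpa using (h7.const_mul z).const_sub 1
    have := (continuousAt_clog (x := 1) (by simp)).tendsto.comp h6
    simpa [Function.comp_def] using this

lemma exp_circle_ne_one {a : ℝ} (ha : a ∈ Ioo (0:ℝ) 1) : cexp (2 * Real.pi * I * a) ≠ 1 := by
  intro h
  rw [Complex.exp_eq_one_iff] at h
  obtain ⟨n, hn⟩ := h
  have h2 : (a : ℂ) = n := by
    have : (2 * Real.pi * I : ℂ) ≠ 0 := Complex.two_pi_I_ne_zero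
    apply mul_left_cancel₀ this; rw [hn]; ring
  have h3 : a = n := by exact_mod_cast h2
  rw [h3] at ha
  obtain ⟨h4, h5⟩ := ha
  have h4' : (0:ℤ) < n := by exact_mod_cast h4
  have h5' : n < (1:ℤ) := by exact_mod_cast h5
  omega

lemma norm_exp_circle (a : ℝ) : ‖cexp (2 * Real.pi * I * a)‖ = 1 := by
  rw [show (2 * Real.pi * I * a : ℂ) = ((2 * Real.pi * a : ℝ) : ℂ) * I by push_cast; ring]
  exact Complex.norm_exp_ofReal_mul_I _

lemma expZeta_gt_one (a : ℝ) {s : ℂ} (hs : 1 < s.re) :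
    mellin (Fz (cexp (2 * Real.pi * I * a))) s = Gamma s * expZeta a s := by
  set z := cexp (2 * Real.pi * I * a) with hz
  have hzn : ‖z‖ = 1 := norm_exp_circle a
  have h1 := hasSum_mellin (a := fun i : ℕ => z ^ (i+1)) (p := fun i => (i + 1 : ℝ)) (F := Fz z) (s := s)
    (fun i => Or.inr (by positivity)) (by linarith) ?_ ?_
  · have h2 := (hasSum_expZeta_of_one_lt_re a hs)
    rw [← hasSum_nat_add_iff' 1] at h2
    have h3 := h2.mul_left (Gamma s)
    refine (h1.unique ?_)
    have hs0 : s ≠ 0 := by rintro rfl; simp at hs; linarith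
    convert! h3 using 1
    · ext i
      rw [hz, ← Complex.exp_nat_mul]
      push_cast
      rw [mul_div_assoc]
      congr 3
      ring
    · simp [hs0]
  · intro t ht
    have h4 : ‖z * (Real.exp (-t) : ℂ)‖ < 1 := by
      rw [norm_mul, hzn, one_mul, Complex.norm_real, Real.norm_of_nonneg (Real.exp_pos _).le]
      simpa using ht
    have h5 := (hasSum_geometric_of_norm_lt_one h4).mul_left (z * (Real.exp (-t) : ℂ))
    rw [← div_eq_mul_inv] at h5
    convert! h5 using 1
    ext i
    rw [← pow_succ', mul_pow, ← Complex.ofReal_pow, ← Real.exp_nat_mul]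
    congr 3
    push_cast; ring
  · simp only [norm_pow, hzn, one_pow]
    have := (summable_nat_add_iff 1).mpr (Real.summable_one_div_nat_rpow.mpr hs)
    simpa using this

lemma expZeta_one {a : ℝ} (ha : a ∈ Ioo (0:ℝ) 1) :
    expZeta a 1 = - Complex.log (1 - cexp (2 * Real.pi * I * a)) := by
  rw [← Fz_mellin (norm_exp_circle a) (exp_circle_ne_one ha)]
  set z := cexp (2 * Real.pi * I * a) with hz
  have hzn : ‖z‖ = 1 := norm_exp_circle a
  have hz1 : z ≠ 1 := exp_circle_ne_one ha
  have ha0 : (a : UnitAddCircle) ≠ 0 := by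
    intro h
    rw [AddCircle.coe_eq_zero_iff] at h
    obtain ⟨n, hn⟩ := h
    simp at hn
    rw [← hn] at ha
    obtain ⟨h4, h5⟩ := ha
    have h4' : (0:ℤ) < n := by exact_mod_cast h4
    have h5' : n < (1:ℤ) := by exact_mod_cast h5
    omega
  have hd : DifferentiableAt ℂ (mellin (Fz z)) 1 :=
    mellin_differentiableAt_of_isBigO_rpow_exp (b := 0) one_pos (Fz_loc hzn hz1) (Fz_top hzn) (Fz_bot hzn hz1) (by simp)
  have he := (differentiable_expZeta_of_ne_zero ha0).continuous
  have hmap : Tendsto (fun x : ℝ => (x : ℂ)) (𝓝[>] 1) (𝓝 1) :=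
    (Complex.continuous_ofReal.tendsto' 1 1 (by simp)).mono_left nhdsWithin_le_nhds
  have l1 : Tendsto (fun x : ℝ => mellin (Fz z) x) (𝓝[>] 1) (𝓝 (mellin (Fz z) 1)) :=
    hd.continuousAt.tendsto.comp hmap
  have l2 : Tendsto (fun x : ℝ => Gamma x * expZeta a x) (𝓝[>] 1) (𝓝 (Gamma 1 * expZeta a 1)) := by
    refine Tendsto.mul ?_ ((he.tendsto _).comp hmap)
    refine (Complex.differentiableAt_Gamma 1 ?_).continuousAt.tendsto.comp hmap
    intro m h
    have := congrArg Complex.re h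
    simp at this
    have hm : (0:ℝ) ≤ m := m.cast_nonneg
    linarith
  have l3 : Tendsto (fun x : ℝ => mellin (Fz z) x) (𝓝[>] 1) (𝓝 (Gamma 1 * expZeta a 1)) := by
    refine l2.congr' ?_
    filter_upwards [self_mem_nhdsWithin] with x hx
    rw [expZeta_gt_one a (by simpa using hx)]
  have := tendsto_nhds_unique l1 l3
  rw [this, Complex.Gamma_one, one_mul]

lemma log_circle {a : ℝ} (ha : a ∈ Ioo (0:ℝ) 1) :
    Complex.log (1 - cexp (2 * Real.pi * I * a)) =
      (Real.log (2 * Real.sin (Real.pi * a)) : ℂ) + (Real.pi * (a - 1/2) : ℝ) * I := by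
  have hs : 0 < Real.sin (Real.pi * a) := Real.sin_pos_of_pos_of_lt_pi
    (mul_pos Real.pi_pos ha.1) (by nlinarith [Real.pi_pos, ha.2])
  have h1 : 1 - cexp (2 * Real.pi * I * a) =
    cexp ((Real.log (2 * Real.sin (Real.pi * a)) : ℂ) + (Real.pi * (a - 1/2) : ℝ) * I) := by
    rw [Complex.exp_add, ← Complex.ofReal_exp, Real.exp_log (by positivity)]
    push_cast
    rw [Complex.sin, show (Real.pi * (a - 1/2) * I : ℂ) = Real.pi * a * I + (- (Real.pi/2 * I)) by ring,
      Complex.exp_add, Complex.exp_neg (Real.pi/2 * I), Complex.exp_pi_div_two_mul_I, Complex.inv_I]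
    rw [show (2 * Real.pi * I * a : ℂ) = Real.pi * a * I + Real.pi * a * I by ring, Complex.exp_add]
    rw [show (-(Real.pi * a) * I : ℂ) = -(Real.pi * a * I) by ring, Complex.exp_neg]
    have : cexp (Real.pi * a * I) ≠ 0 := Complex.exp_ne_zero _
    field_simp
    ring_nf
    rw [Complex.I_sq]; ring
  rw [h1, Complex.log_exp]
  · simp; nlinarith [Real.pi_pos, ha.1, ha.2]
  · simp; nlinarith [Real.pi_pos, ha.1, ha.2]

end C1
section C2
open Complex HurwitzZeta Filter Topology Set MeasureTheory ZMod

noncomputable def chiC (p : ℕ) [Fact p.Prime] : DirichletCharacter ℂ p :=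
  (quadraticChar (ZMod p)).ringHomComp (Int.castRingHom ℂ)

lemma chiC_apply (p : ℕ) [Fact p.Prime] (a : ZMod p) : chiC p a = ((quadraticChar (ZMod p) a : ℤ) : ℂ) := by
  simp [chiC, MulChar.ringHomComp_apply]

lemma chiC_ne_one (p : ℕ) [Fact p.Prime] (hp : p ≠ 2) : chiC p ≠ 1 := by
  rw [chiC, MulChar.ringHomComp_ne_one_iff (RingHom.injective_int _)]
  exact quadraticChar_ne_one (by rwa [ZMod.ringChar_zmod_n])

lemma chiC_primitive (p : ℕ) [Fact p.Prime] (hp : p ≠ 2) : (chiC p).IsPrimitive := by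
  rw [DirichletCharacter.isPrimitive_def]
  have h := DirichletCharacter.conductor_dvd_level (chiC p)
  rcases (Nat.dvd_prime Fact.out).mp h with h | h
  · exact absurd ((DirichletCharacter.eq_one_iff_conductor_eq_one).mpr h) (chiC_ne_one p hp)
  · exact h

lemma chiC_inv (p : ℕ) [Fact p.Prime] : (chiC p)⁻¹ = chiC p := by
  apply MulChar.IsQuadratic.inv
  exact MulChar.IsQuadratic.comp (quadraticChar_isQuadratic _) _

lemma chiC_neg (p : ℕ) [Fact p.Prime] (hp : p ≠ 2) (h3 : p % 4 = 3) (a : ZMod p) : chiC p (-a) = - chiC p a := by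
  rw [chiC_apply, chiC_apply, quad_neg, quad_neg_one_three p hp h3]; simp

lemma expZeta_zmod (p : ℕ) [Fact p.Prime] (a : ZMod p) (ha : a ≠ 0) :
    expZeta (toAddCircle (-a)) 1 = -(Real.log (2 * Real.sin (Real.pi * (a.val / p : ℝ))) : ℂ)
      + (Real.pi * (a.val / p - 1/2) : ℝ) * I := by
  have hp : (0:ℝ) < p := by exact_mod_cast (Fact.out : p.Prime).pos
  have hn : NeZero a := ⟨ha⟩
  have hv : 0 < a.val := Nat.pos_of_ne_zero (by rwa [ne_eq, ZMod.val_eq_zero])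
  have hv2 := a.val_lt
  have h1 : ((-a).val / p : ℝ) = 1 - (a.val / p : ℝ) := by
    rw [ZMod.val_neg_of_ne_zero, Nat.cast_sub hv2.le]; field_simp
  have hm : (1 - (a.val / p : ℝ)) ∈ Ioo (0:ℝ) 1 := by
    have hv' : (0:ℝ) < a.val := by exact_mod_cast hv
    have hv2' : (a.val : ℝ) < p := by exact_mod_cast hv2
    have h2 : (a.val / p : ℝ) < 1 := by rwa [div_lt_one hp]
    have h3 : (0:ℝ) < (a.val / p : ℝ) := by positivity
    constructor <;> linarith
  rw [toAddCircle_apply, h1, expZeta_one hm, log_circle hm]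
  rw [show Real.pi * (1 - (a.val / p : ℝ)) = Real.pi - Real.pi * (a.val / p : ℝ) by ring, Real.sin_pi_sub]
  push_cast; ring

lemma L_one (p : ℕ) [Fact p.Prime] (hp : p ≠ 2) (h3 : p % 4 = 3) :
    gaussSum (chiC p) stdAddChar * DirichletCharacter.LFunction (chiC p) 1 =
      - (Real.pi * I * (chiSum p : ℂ) / p) := by
  have hp0 : (p:ℂ) ≠ 0 := by exact_mod_cast (Fact.out : p.Prime).ne_zero
  have h1 := LFunction_dft (chiC p) (s := 1) (Or.inl (by rw [chiC_apply]; simp))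
  have h2 : ZMod.LFunction (ZMod.dft (chiC p : ZMod p → ℂ)) 1 =
     - (gaussSum (chiC p) stdAddChar * DirichletCharacter.LFunction (chiC p) 1) := by
    have hj : ∀ j, ZMod.dft (chiC p : ZMod p → ℂ) j = -(gaussSum (chiC p) stdAddChar) * chiC p j := by
      intro j
      rw [(chiC_primitive p hp).fourierTransform_eq_inv_mul_gaussSum j, chiC_inv, chiC_neg p hp h3]
      ring
    rw [DirichletCharacter.LFunction, ZMod.LFunction, ZMod.LFunction]
    simp_rw [hj]
    simp_rw [mul_assoc]
    rw [← Finset.mul_sum]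
    ring
  have h4 : ∀ j : ZMod p, chiC p j * expZeta (toAddCircle (-j)) 1 =
     chiC p j * (-(Real.log (2 * Real.sin (Real.pi * (j.val / p : ℝ))) : ℂ))
      + Real.pi * I * (chiC p j * j.val) / p - Real.pi * I / 2 * chiC p j := by
    intro j
    by_cases hj : j = 0
    · have : chiC p j = 0 := by rw [hj, chiC_apply]; simp
      rw [this]; simp
    · rw [expZeta_zmod p j hj]; push_cast; ring
  have h5 : ∑ j : ZMod p, chiC p j * (-(Real.log (2 * Real.sin (Real.pi * (j.val / p : ℝ))) : ℂ)) = 0 := by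
    have : ∑ j : ZMod p, chiC p j * (-(Real.log (2 * Real.sin (Real.pi * (j.val / p : ℝ))) : ℂ)) =
      - ∑ j : ZMod p, chiC p j * (-(Real.log (2 * Real.sin (Real.pi * (j.val / p : ℝ))) : ℂ)) := by
      conv_lhs => rw [← Equiv.sum_comp (Equiv.neg _)]
      rw [← Finset.sum_neg_distrib]
      refine Finset.sum_congr rfl fun j _ => ?_
      simp only [Equiv.neg_apply]
      rw [chiC_neg p hp h3]
      by_cases hj : j = 0
      · have : chiC p j = 0 := by rw [hj, chiC_apply]; simp
        rw [this]; simp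
      · have hn : NeZero j := ⟨hj⟩
        have h6 : ((-j).val / p : ℝ) = 1 - (j.val / p : ℝ) := by
          have hp : (0:ℝ) < p := by exact_mod_cast (Fact.out : p.Prime).pos
          rw [ZMod.val_neg_of_ne_zero, Nat.cast_sub j.val_lt.le]; field_simp
        rw [h6, show Real.pi * (1 - (j.val / p : ℝ)) = Real.pi - Real.pi * (j.val / p : ℝ) by ring, Real.sin_pi_sub]
        ring
    exact self_eq_neg.mp this
  have h6 : ∑ j : ZMod p, chiC p j = 0 := MulChar.sum_eq_zero_of_ne_one (chiC_ne_one p hp)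
  have h7 : ∑ j : ZMod p, chiC p j * (j.val : ℂ) = (chiSum p : ℂ) := by
    rw [chiSum]; push_cast
    refine Finset.sum_congr rfl fun j _ => ?_
    rw [chiC_apply]
  rw [h2, Finset.sum_congr rfl (fun j _ => h4 j), Finset.sum_sub_distrib, Finset.sum_add_distrib, h5,
    ← Finset.mul_sum, h6, ← Finset.sum_div, ← Finset.mul_sum, h7] at h1
  linear_combination -h1

end C2

section SC3
open Complex Filter Topology Set NumberField

lemma L_one_eq_residue (p : ℕ) [Fact p.Prime] (hp : p ≠ 2) (K : Type) [Field K] [NumberField K]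
    (hc : ∀ n : ℕ, n ≠ 0 → (Nat.card {I : Ideal (𝓞 K) // Ideal.absNorm I = n} : ℤ) =
      ∑ d ∈ n.divisors, quadraticChar (ZMod p) (d : ZMod p)) :
    DirichletCharacter.LFunction (chiC p) 1 = (dedekindZeta_residue K : ℂ) := by
  have h1 : ∀ s : ℂ, 1 < s.re → dedekindZeta K s =
      riemannZeta s * DirichletCharacter.LFunction (chiC p) s := by
    intro s hs
    rw [DirichletCharacter.LFunction_eq_LSeries _ hs, ← LSeries_one_eq_riemannZeta hs,
      ← LSeries_convolution' (LSeriesSummable_one_iff.mpr hs)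
        (DirichletCharacter.LSeriesSummable_of_one_lt_re (chiC p) hs), dedekindZeta]
    apply LSeries_congr
    intro n hn
    rw [LSeries.convolution_def]
    have := hc n hn
    simp only [Pi.one_apply, one_mul]
    rw [Nat.sum_divisorsAntidiagonal' (f := fun _ y => chiC p ((y : ℕ) : ZMod p))]
    have h2 : ((Nat.card {I : Ideal (𝓞 K) // Ideal.absNorm I = n} : ℤ) : ℂ) =
      ((∑ d ∈ n.divisors, quadraticChar (ZMod p) (d : ZMod p) : ℤ) : ℂ) := by rw [this]
    rw [Int.cast_natCast, Int.cast_sum] at h2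
    rw [h2]
    exact Finset.sum_congr rfl fun d _ => (chiC_apply p _).symm
  have h2 := tendsto_sub_one_mul_dedekindZeta_nhdsGT K
  have hm : Tendsto (fun s : ℝ => (s : ℂ)) (𝓝[>] 1) (𝓝[≠] 1) := by
    apply tendsto_nhdsWithin_of_tendsto_nhds_of_eventually_within
    · exact (Complex.continuous_ofReal.tendsto' 1 1 (by simp)).mono_left nhdsWithin_le_nhds
    · filter_upwards [self_mem_nhdsWithin] with s hs
      have : s ≠ 1 := ne_of_gt hs
      simpa using this
  have h3 : Tendsto (fun s : ℝ => ((s : ℂ) - 1) * riemannZeta s) (𝓝[>] 1) (𝓝 1) :=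
    riemannZeta_residue_one.comp hm
  have h4 : Tendsto (fun s : ℝ => DirichletCharacter.LFunction (chiC p) (s : ℂ)) (𝓝[>] 1)
      (𝓝 (DirichletCharacter.LFunction (chiC p) 1)) :=
    ((DirichletCharacter.differentiable_LFunction (chiC_ne_one p hp)).continuous.tendsto 1).comp
      (hm.mono_right nhdsWithin_le_nhds)
  have h5 := h3.mul h4
  rw [one_mul] at h5
  refine tendsto_nhds_unique (h5.congr' ?_) h2
  filter_upwards [self_mem_nhdsWithin] with s hs
  rw [h1 s (by simpa using hs)]
  ring

end SC3

section SA1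
open NumberField

noncomputable def idealCount (K : Type) [Field K] [NumberField K] (n : ℕ) : ℕ :=
  Nat.card {I : Ideal (𝓞 K) // Ideal.absNorm I = n}

lemma natCast_mem_of_absNorm {K : Type} [Field K] [NumberField K] {I : Ideal (𝓞 K)} {n : ℕ}
    (h : Ideal.absNorm I = n) : (n : 𝓞 K) ∈ I := h ▸ Ideal.absNorm_mem I

lemma span_sup_span_coprime {K : Type} [Field K] [NumberField K] {m n : ℕ} (h : m.Coprime n) 
    {J J' : Ideal (𝓞 K)} (hJ : (m : 𝓞 K) ∈ J) (hJ' : (n : 𝓞 K) ∈ J') : J ⊔ J' = ⊤ := by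
  rw [Ideal.eq_top_iff_one]
  have h1 : IsCoprime (m : 𝓞 K) (n : 𝓞 K) := Nat.Coprime.cast h
  obtain ⟨a, b, hab⟩ := h1
  rw [← hab]
  exact Ideal.add_mem _ (Ideal.mem_sup_left (J.mul_mem_left _ hJ)) (Ideal.mem_sup_right (J'.mul_mem_left _ hJ'))

lemma recover {K : Type} [Field K] [NumberField K] {m n : ℕ} (h : m.Coprime n) 
    {I J : Ideal (𝓞 K)} (hI : (m : 𝓞 K) ∈ I) (hJ : (n : 𝓞 K) ∈ J) : I * J ⊔ Ideal.span {(m : 𝓞 K)} = I := by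
  apply le_antisymm
  · exact sup_le Ideal.mul_le_left ((Ideal.span_singleton_le_iff_mem _).mpr hI)
  · have h1 : Ideal.span {(m : 𝓞 K)} ⊔ J = ⊤ := span_sup_span_coprime h (Ideal.mem_span_singleton_self _) hJ
    calc I = I * (Ideal.span {(m : 𝓞 K)} ⊔ J) := by rw [h1, Ideal.mul_top]
      _ = I * Ideal.span {(m : 𝓞 K)} ⊔ I * J := Ideal.mul_sup _ _ _
      _ ≤ _ := sup_le (Ideal.mul_le_right.trans le_sup_right) le_sup_left

lemma idealCount_mul (K : Type) [Field K] [NumberField K] {m n : ℕ} (hm : m ≠ 0) (hn : n ≠ 0) (h : m.Coprime n) :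
    idealCount K (m * n) = idealCount K m * idealCount K n := by
  rw [idealCount, idealCount, idealCount, ← Nat.card_prod]
  symm
  apply Nat.card_congr
  refine Equiv.ofBijective (fun x => ⟨x.1.1 * x.2.1, by rw [map_mul, x.1.2, x.2.2]⟩) ⟨?_, ?_⟩
  · rintro ⟨⟨I, hI⟩, ⟨J, hJ⟩⟩ ⟨⟨I', hI'⟩, ⟨J', hJ'⟩⟩ hh
    simp only [Subtype.mk.injEq] at hh
    have a1 := recover h (natCast_mem_of_absNorm hI) (natCast_mem_of_absNorm hJ)
    have a2 := recover h (natCast_mem_of_absNorm hI') (natCast_mem_of_absNorm hJ')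
    have b1 := recover h.symm (natCast_mem_of_absNorm hJ) (natCast_mem_of_absNorm hI)
    have b2 := recover h.symm (natCast_mem_of_absNorm hJ') (natCast_mem_of_absNorm hI')
    rw [mul_comm] at b1 b2
    have c1 : I = I' := by rw [← a1, hh, a2]
    have c2 : J = J' := by rw [← b1, hh, b2]
    subst c1 c2; rfl
  · rintro ⟨L, hL⟩
    have hmem := natCast_mem_of_absNorm hL
    set A := L ⊔ Ideal.span {(m : 𝓞 K)} with hA
    set B := L ⊔ Ideal.span {(n : 𝓞 K)} with hB
    have hAB : A * B = L := by
      apply le_antisymm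
      · rw [hA, hB, Ideal.sup_mul, Ideal.mul_sup, Ideal.mul_sup]
        refine sup_le (sup_le Ideal.mul_le_right Ideal.mul_le_left) (sup_le Ideal.mul_le_right ?_)
        rw [Ideal.span_singleton_mul_span_singleton, Ideal.span_singleton_le_iff_mem]
        exact_mod_cast hmem
      · have h1 : Ideal.span {(m : 𝓞 K)} ⊔ Ideal.span {(n : 𝓞 K)} = ⊤ :=
          span_sup_span_coprime h (Ideal.mem_span_singleton_self _) (Ideal.mem_span_singleton_self _)
        calc L = L * (Ideal.span {(m : 𝓞 K)} ⊔ Ideal.span {(n : 𝓞 K)}) := by rw [h1, Ideal.mul_top]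
          _ = L * Ideal.span {(m : 𝓞 K)} ⊔ L * Ideal.span {(n : 𝓞 K)} := Ideal.mul_sup _ _ _
          _ ≤ _ := sup_le (by rw [mul_comm]; exact Ideal.mul_mono le_sup_right le_sup_left) 
              (Ideal.mul_mono le_sup_left le_sup_right)
    have hN : Ideal.absNorm A * Ideal.absNorm B = m * n := by rw [← map_mul, hAB, hL]
    have key : ∀ k : ℕ, Ideal.absNorm (L ⊔ Ideal.span {(k : 𝓞 K)}) ∣ k ^ (Module.finrank ℤ (𝓞 K)) := by
      intro k
      rw [← Ideal.absNorm_span_natCast]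
      exact Ideal.absNorm_dvd_absNorm_of_le le_sup_right
    have hA1 : Ideal.absNorm A ∣ m := by
      have : (Ideal.absNorm A).Coprime n := Nat.Coprime.coprime_dvd_left (key m) (Nat.Coprime.pow_left _ h)
      exact this.dvd_of_dvd_mul_right (hN ▸ Dvd.intro _ rfl)
    have hB1 : Ideal.absNorm B ∣ n := by
      have : (Ideal.absNorm B).Coprime m := Nat.Coprime.coprime_dvd_left (key n) (Nat.Coprime.pow_left _ h.symm)
      exact this.dvd_of_dvd_mul_left (hN ▸ Dvd.intro_left _ rfl)
    have hA2 : Ideal.absNorm A = m := by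
      have h1 := Nat.le_of_dvd (Nat.pos_of_ne_zero hm) hA1
      have h2 := Nat.le_of_dvd (Nat.pos_of_ne_zero hn) hB1
      have hn' := Nat.pos_of_ne_zero hn
      nlinarith
    have hB2 : Ideal.absNorm B = n := by
      rw [hA2] at hN
      exact Nat.eq_of_mul_eq_mul_left (Nat.pos_of_ne_zero hm) hN
    exact ⟨⟨⟨A, hA2⟩, ⟨B, hB2⟩⟩, Subtype.ext hAB⟩

lemma le_dvd_pow {K : Type} [Field K] [NumberField K] {I : Ideal (𝓞 K)} {q k : ℕ}
    (h : Ideal.absNorm I = q ^ k) : I ∣ Ideal.span {(q : 𝓞 K)} ^ k := by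
  rw [Ideal.dvd_iff_le, Ideal.span_singleton_pow, Ideal.span_singleton_le_iff_mem]
  exact_mod_cast natCast_mem_of_absNorm h

/-- ramified -/
lemma idealCount_ram (K : Type) [Field K] [NumberField K] {q : ℕ} (hq : q.Prime) (k : ℕ) {P : Ideal (𝓞 K)}
    (hP : Prime P) (hPq : P ^ 2 = Ideal.span {(q : 𝓞 K)}) (hN : Ideal.absNorm P = q) :
    idealCount K (q ^ k) = 1 := by
  rw [idealCount, Nat.card_eq_one_iff_exists]
  refine ⟨⟨P ^ k, by rw [map_pow, hN]⟩, ?_⟩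
  rintro ⟨I, hI⟩
  have h1 := le_dvd_pow hI
  rw [← hPq, ← pow_mul, dvd_prime_pow hP] at h1
  obtain ⟨i, -, hi⟩ := h1
  rw [associated_iff_eq] at hi
  subst hi
  rw [map_pow, hN] at hI
  have := Nat.pow_right_injective hq.two_le hI
  simp only [this]

/-- inert -/
lemma idealCount_inert (K : Type) [Field K] [NumberField K] {q : ℕ} (hq : q.Prime) (k : ℕ)
    (hP : Prime (Ideal.span {(q : 𝓞 K)})) (hN : Ideal.absNorm (Ideal.span {(q : 𝓞 K)}) = q ^ 2) :
    idealCount K (q ^ k) = if Even k then 1 else 0 := by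
  have key : ∀ I : Ideal (𝓞 K), Ideal.absNorm I = q ^ k → ∃ i, I = Ideal.span {(q : 𝓞 K)} ^ i ∧ 2 * i = k := by
    intro I hI
    have h1 := le_dvd_pow hI
    rw [dvd_prime_pow hP] at h1
    obtain ⟨i, -, hi⟩ := h1
    rw [associated_iff_eq] at hi
    refine ⟨i, hi, ?_⟩
    rw [hi, map_pow, hN, ← pow_mul] at hI
    exact Nat.pow_right_injective hq.two_le hI
  split_ifs with hk
  · obtain ⟨j, rfl⟩ := hk
    rw [idealCount, Nat.card_eq_one_iff_exists]
    refine ⟨⟨Ideal.span {(q : 𝓞 K)} ^ j, by rw [map_pow, hN, ← pow_mul]; congr 1; ring⟩, ?_⟩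
    rintro ⟨I, hI⟩
    obtain ⟨i, hi, hij⟩ := key I hI
    have : i = j := by omega
    subst this
    simp only [hi]
  · rw [idealCount, Nat.card_eq_zero]
    left
    constructor
    rintro ⟨I, hI⟩
    obtain ⟨i, hi, hij⟩ := key I hI
    exact hk ⟨i, by omega⟩

/-- split -/
lemma idealCount_split (K : Type) [Field K] [NumberField K] {q : ℕ} (hq : q.Prime) (k : ℕ) {P Q : Ideal (𝓞 K)}
    (hP : Prime P) (hQ : Prime Q) (hne : P ≠ Q) (hPq : P * Q = Ideal.span {(q : 𝓞 K)})
    (hNP : Ideal.absNorm P = q) (hNQ : Ideal.absNorm Q = q) :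
    idealCount K (q ^ k) = k + 1 := by
  have hcard : Nat.card (Fin (k + 1)) = k + 1 := by simp
  rw [idealCount, ← hcard]
  symm
  apply Nat.card_congr
  have hnd : ∀ a : ℕ, ¬ P ∣ Q ^ a := fun a ha => by
    have h1 := hP.dvd_of_dvd_pow ha
    have := (hP.dvd_prime_iff_associated hQ).mp h1
    exact hne (associated_iff_eq.mp this)
  have hlt : ∀ i j a b : ℕ, P ^ i * Q ^ a = P ^ j * Q ^ b → ¬ i < j := by
    intro i j a b h hij
    obtain ⟨c, rfl⟩ := Nat.exists_eq_add_of_lt hij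
    rw [show P ^ (i + c + 1) * Q ^ b = P ^ i * (P * (P ^ c * Q ^ b)) by ring] at h
    have h2 := mul_left_cancel₀ (pow_ne_zero i hP.ne_zero) h
    exact hnd a (h2 ▸ Dvd.intro _ rfl)
  refine Equiv.ofBijective (fun i => ⟨P ^ (i : ℕ) * Q ^ (k - i : ℕ), by
    rw [map_mul, map_pow, map_pow, hNP, hNQ, ← pow_add]; congr 1; omega⟩) ⟨?_, ?_⟩
  · intro i j hij
    simp only [Subtype.mk.injEq] at hij
    have h1 := hlt _ _ _ _ hij
    have h2 := hlt _ _ _ _ hij.symm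
    ext; omega
  · rintro ⟨I, hI⟩
    have h1 := le_dvd_pow hI
    rw [← hPq, mul_pow] at h1
    obtain ⟨A, B, hA, hB, hAB⟩ := exists_dvd_and_dvd_of_dvd_mul h1
    obtain ⟨i, -, hi⟩ := (dvd_prime_pow hP _).mp hA
    obtain ⟨j, -, hj⟩ := (dvd_prime_pow hQ _).mp hB
    rw [associated_iff_eq] at hi hj
    subst hi hj
    subst hAB
    rw [map_mul, map_pow, map_pow, hNP, hNQ, ← pow_add] at hI
    have := Nat.pow_right_injective hq.two_le hI
    refine ⟨⟨i, by omega⟩, ?_⟩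
    simp only [Subtype.mk.injEq]
    congr 2; omega

end SA1

section SA2
open NumberField

lemma idealCount_eq_of_prime_pow (p : ℕ) [Fact p.Prime] (K : Type) [Field K] [NumberField K]
    (h : ∀ q k : ℕ, q.Prime → (idealCount K (q ^ k) : ℤ) =
      ∑ i ∈ Finset.range (k + 1), (quadraticChar (ZMod p) (q : ZMod p)) ^ i) (n : ℕ) (hn : n ≠ 0) :
    (idealCount K n : ℤ) = ∑ d ∈ n.divisors, quadraticChar (ZMod p) (d : ZMod p) := by
  let g : ArithmeticFunction ℤ := ⟨fun n => quadraticChar (ZMod p) (n : ZMod p), by simp⟩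
  have hg : g.IsMultiplicative := by
    refine ⟨by simp [g], ?_⟩
    intro m n _
    change quadraticChar (ZMod p) ((m * n : ℕ) : ZMod p) = _
    rw [Nat.cast_mul, map_mul]; rfl
  have hgz : (g * (ArithmeticFunction.zeta : ArithmeticFunction ℤ)).IsMultiplicative :=
    hg.mul ArithmeticFunction.isMultiplicative_zeta.natCast
  have hgz' : ∀ n, (g * (ArithmeticFunction.zeta : ArithmeticFunction ℤ)) n =
      ∑ d ∈ n.divisors, quadraticChar (ZMod p) (d : ZMod p) := by
    intro n
    rw [ArithmeticFunction.coe_mul_zeta_apply]; rfl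
  rw [← hgz']
  induction n using Nat.recOnPosPrimePosCoprime with
  | prime_pow q k hq hk =>
    rw [h q k hq, hgz', Nat.sum_divisors_prime_pow hq]
    refine Finset.sum_congr rfl fun i _ => ?_
    rw [Nat.cast_pow, map_pow]
  | zero => exact absurd rfl hn
  | one =>
    rw [hgz.1]
    have := h 2 0 Nat.prime_two
    simpa using this
  | coprime a b ha hb hab iha ihb =>
    rw [idealCount_mul K (by omega) (by omega) hab, hgz.2 hab, ← iha (by omega), ← ihb (by omega)]
    push_cast; rfl

end SA2

section SB1
open NumberField

lemma rep_Q {p : ℕ} {K : Type} [Field K] [NumberField K] (α : K) (hα : α ^ 2 = -(p : K))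
    (hgen : IntermediateField.adjoin ℚ {α} = ⊤) (x : K) : ∃ a b : ℚ, x = a + b * α := by
  have hInt : IsIntegral ℚ α := Algebra.IsIntegral.isIntegral α
  have h1 : Algebra.adjoin ℚ {α} = ⊤ := by
    rw [← IntermediateField.adjoin_simple_toSubalgebra_of_isAlgebraic hInt.isAlgebraic, hgen]; rfl
  have hx : x ∈ Algebra.adjoin ℚ {α} := h1 ▸ Algebra.mem_top
  induction hx using Algebra.adjoin_induction with
  | mem x hx => rw [Set.mem_singleton_iff] at hx; exact ⟨0, 1, by simp [hx]⟩
  | algebraMap r => exact ⟨r, 0, by simp⟩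
  | add x y _ _ hx hy =>
    obtain ⟨a, b, rfl⟩ := hx
    obtain ⟨c, d, rfl⟩ := hy
    exact ⟨a + c, b + d, by push_cast; ring⟩
  | mul x y _ _ hx hy =>
    obtain ⟨a, b, rfl⟩ := hx
    obtain ⟨c, d, rfl⟩ := hy
    exact ⟨a * c - p * b * d, a * d + b * c, by push_cast; linear_combination (b * d : K) * hα⟩

lemma uniq_Q {p : ℕ} (hp : 0 < p) {K : Type} [Field K] [NumberField K] (α : K) (hα : α ^ 2 = -(p : K))
    {a b : ℚ} (h : (a : K) + b * α = 0) : a = 0 ∧ b = 0 := by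
  have h1 : ((a ^ 2 + p * b ^ 2 : ℚ) : K) = 0 := by
    push_cast; linear_combination (a - b * α) * h + (b : K) ^ 2 * hα
  have h2 : a ^ 2 + p * b ^ 2 = 0 := by exact_mod_cast h1
  have hp' : (0 : ℚ) < p := by exact_mod_cast hp
  have hb : b = 0 := by
    by_contra hb
    have : 0 < b ^ 2 := by positivity
    nlinarith [sq_nonneg a]
  subst hb
  simpa using h2

lemma exists_basis_Q {p : ℕ} (hp : 0 < p) {K : Type} [Field K] [NumberField K] (α : K) (hα : α ^ 2 = -(p : K))
    (hgen : IntermediateField.adjoin ℚ {α} = ⊤) : ∃ b : Module.Basis (Fin 2) ℚ K, b 0 = 1 ∧ b 1 = α := by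
  have hli : LinearIndependent ℚ ![(1 : K), α] := by
    rw [LinearIndependent.pair_iff]
    intro s t h
    apply uniq_Q hp α hα
    simpa [Algebra.smul_def] using h
  suffices hs : ⊤ ≤ Submodule.span ℚ (Set.range ![(1 : K), α]) from
    ⟨Module.Basis.mk hli hs, by simp [Module.Basis.mk_apply], by simp [Module.Basis.mk_apply]⟩
  rintro x -
  obtain ⟨a, b, rfl⟩ := rep_Q α hα hgen x
  have : (a : K) + b * α = a • (1 : K) + b • α := by simp [Algebra.smul_def]
  rw [this]
  refine add_mem (Submodule.smul_mem _ _ (Submodule.subset_span ⟨0, rfl⟩)) (Submodule.smul_mem _ _ (Submodule.subset_span ⟨1, rfl⟩))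

lemma norm_trace_Q {p : ℕ} (hp : 0 < p) {K : Type} [Field K] [NumberField K] (α : K) (hα : α ^ 2 = -(p : K))
    (hgen : IntermediateField.adjoin ℚ {α} = ⊤) (a c : ℚ) : 
    Algebra.norm ℚ ((a : K) + c * α) = a ^ 2 + p * c ^ 2 ∧ Algebra.trace ℚ K ((a : K) + c * α) = 2 * a := by
  obtain ⟨b, h0, h1⟩ := exists_basis_Q hp α hα hgen
  have r0 : b.repr 1 = Finsupp.single 0 1 := by rw [← h0, b.repr_self]
  have r1 : b.repr α = Finsupp.single 1 1 := by rw [← h1, b.repr_self]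
  have e0 : b.repr ((a : K) + c * α) = a • Finsupp.single 0 1 + c • Finsupp.single 1 1 := by
    rw [← r0, ← r1, ← map_smul, ← map_smul, ← map_add]; simp [Algebra.smul_def]
  have e1 : b.repr (((a : K) + c * α) * α) = (- p * c) • Finsupp.single 0 1 + a • Finsupp.single 1 1 := by
    rw [← r0, ← r1, ← map_smul, ← map_smul, ← map_add]; congr 1; simp only [Algebra.smul_def, eq_ratCast]
    push_cast
    linear_combination (c : K) * hα
  have m : Algebra.leftMulMatrix b ((a : K) + c * α) = !![a, - p * c; c, a] := by
    ext i j
    rw [Algebra.leftMulMatrix_eq_repr_mul]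
    fin_cases j
    · simp only [Fin.zero_eta, h0, mul_one, e0]
      fin_cases i <;> simp
    · simp only [Fin.mk_one, h1, e1]
      fin_cases i <;> simp
  rw [Algebra.norm_eq_matrix_det b, Algebra.trace_eq_matrix_trace b, m, Matrix.det_fin_two_of, Matrix.trace_fin_two_of]
  constructor <;> ring

lemma finrank_K {p : ℕ} (hp : 0 < p) {K : Type} [Field K] [NumberField K] (α : K) (hα : α ^ 2 = -(p : K))
    (hgen : IntermediateField.adjoin ℚ {α} = ⊤) : Module.finrank ℚ K = 2 := by
  obtain ⟨b, h0, h1⟩ := exists_basis_Q hp α hα hgen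
  rw [Module.finrank_eq_card_basis b]; simp

lemma int_of_sq {p : ℕ} (hp : p.Prime) (b : ℚ) (n : ℤ) (h : p * b ^ 2 = n) : ∃ m : ℤ, b = m := by
  have h1 : (p * n : ℚ) = (p * b) ^ 2 := by rw [← h]; ring
  obtain ⟨c, hc⟩ : ∃ c : ℤ, p * b = c := by
    have : IsIntegral ℤ (p * b) := by
      apply IsIntegral.of_pow (n := 2) (by norm_num)
      rw [← h1]
      have := isIntegral_algebraMap (R := ℤ) (A := ℚ) (x := (p * n : ℤ))
      simpa using this
    obtain ⟨c, hc⟩ := IsIntegrallyClosed.isIntegral_iff.mp this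
    exact ⟨c, by simpa using hc.symm⟩
  rw [hc] at h1
  have h2 : (p * n : ℤ) = c ^ 2 := by exact_mod_cast h1
  have h3 : (p : ℤ) ∣ c := (Nat.prime_iff_prime_int.mp hp).dvd_of_dvd_pow (h2 ▸ Dvd.intro _ rfl)
  obtain ⟨m, rfl⟩ := h3
  refine ⟨m, ?_⟩
  have hp0 : (p : ℚ) ≠ 0 := by exact_mod_cast hp.ne_zero
  push_cast at hc
  exact mul_left_cancel₀ hp0 hc

lemma rep_half {p : ℕ} (hp : p.Prime) (h3 : p % 4 = 3) {K : Type} [Field K] [NumberField K] (α : K) (hα : α ^ 2 = -(p : K))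
    (hgen : IntermediateField.adjoin ℚ {α} = ⊤) (x : 𝓞 K) : ∃ m n : ℤ, (x : K) = m + n * ((1 + α) / 2) := by
  obtain ⟨a, b, hx⟩ := rep_Q α hα hgen x
  obtain ⟨hN, hT⟩ := norm_trace_Q hp.pos α hα hgen a b
  rw [← hx] at hN hT
  have hxi : IsIntegral ℤ (x : K) := x.2
  obtain ⟨N, hN'⟩ := IsIntegrallyClosed.isIntegral_iff.mp (Algebra.isIntegral_norm ℚ hxi)
  obtain ⟨u, hu⟩ := IsIntegrallyClosed.isIntegral_iff.mp (Algebra.isIntegral_trace (L := ℚ) hxi)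
  rw [hN] at hN'
  rw [hT] at hu
  simp only [algebraMap_int_eq, eq_intCast] at hN' hu
  obtain ⟨v, hv⟩ := int_of_sq hp (2 * b) (4 * N - u ^ 2) (by push_cast; rw [hN', hu]; ring)
  have hq : u ^ 2 + p * v ^ 2 = 4 * N := by
    have : ((u ^ 2 + p * v ^ 2 : ℤ) : ℚ) = ((4 * N : ℤ) : ℚ) := by
      push_cast; rw [hN', hu, ← hv]; ring
    exact_mod_cast this
  have hev : (2 : ℤ) ∣ u - v := by
    obtain ⟨t, ht⟩ : ∃ t, p = 4 * t + 3 := ⟨p / 4, by omega⟩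
    rw [ht] at hq
    push_cast at hq
    have h5 : (2 : ℤ) ∣ (u - v) ^ 2 := ⟨2 * N - 2 * t * v ^ 2 - v ^ 2 - u * v, by linear_combination hq⟩
    exact Int.prime_two.dvd_of_dvd_pow h5
  obtain ⟨m, hm⟩ := hev
  refine ⟨m, v, ?_⟩
  rw [hx]
  have hm' : (u : ℚ) = 2 * m + v := by
    have : u = 2 * m + v := by linear_combination hm
    rw [this]; push_cast; ring
  have ha : a = m + v / 2 := by linear_combination (-hu + hm') / 2
  have hb : b = v / 2 := by linear_combination hv / 2
  rw [ha, hb]; push_cast; ring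

end SB1

section SB2
open NumberField

lemma exists_theta {p t : ℕ} (ht : p + 1 = 4 * t) {K : Type} [Field K] [NumberField K] (α : K) (hα : α ^ 2 = -(p : K)) :
    ∃ θ : 𝓞 K, (θ : K) = (1 + α) / 2 ∧ θ ^ 2 = θ - (t : 𝓞 K) := by
  have hp : (p : K) + 1 = 4 * (t : K) := by
    exact_mod_cast congrArg (Nat.cast (R := K)) ht
  have h1 : ((1 + α) / 2) ^ 2 = (1 + α) / 2 - (t : K) := by
    linear_combination hα / 4 - hp / 4
  have hInt : IsIntegral ℤ ((1 + α) / 2) := by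
    refine ⟨Polynomial.X ^ 2 - Polynomial.X + Polynomial.C (t : ℤ), by monicity!, ?_⟩
    rw [← Polynomial.aeval_def]
    simp only [map_add, map_sub, map_pow, Polynomial.aeval_X, Polynomial.aeval_C]
    rw [h1]; simp
  obtain ⟨θ, hθ⟩ : ∃ θ : 𝓞 K, (θ : K) = (1 + α) / 2 := ⟨⟨_, hInt⟩, rfl⟩
  refine ⟨θ, hθ, ?_⟩
  apply RingOfIntegers.ext
  simp only [map_pow, map_sub, map_natCast, hθ, h1]

lemma rep_O {p : ℕ} (hp : p.Prime) (h3 : p % 4 = 3) {K : Type} [Field K] [NumberField K] (α : K) (hα : α ^ 2 = -(p : K))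
    (hgen : IntermediateField.adjoin ℚ {α} = ⊤) {θ : 𝓞 K} (hθ : (θ : K) = (1 + α) / 2) (x : 𝓞 K) :
    ∃ m n : ℤ, x = m + n * θ := by
  obtain ⟨m, n, h⟩ := rep_half hp h3 α hα hgen x
  exact ⟨m, n, RingOfIntegers.ext (by simp [h, hθ])⟩

lemma uniq_O {p : ℕ} (hp : p.Prime) {K : Type} [Field K] [NumberField K] (α : K) (hα : α ^ 2 = -(p : K))
    {θ : 𝓞 K} (hθ : (θ : K) = (1 + α) / 2) {m n : ℤ} (h : (m : 𝓞 K) + n * θ = 0) : m = 0 ∧ n = 0 := by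
  have h1 : (m : K) + n * (θ : K) = 0 := by 
    have := congrArg (algebraMap (𝓞 K) K) h
    simpa only [map_add, map_mul, map_zero, map_intCast] using this
  have h2 : ((m + n / 2 : ℚ) : K) + (n / 2 : ℚ) * α = 0 := by
    rw [hθ] at h1; push_cast; linear_combination h1
  obtain ⟨a, b⟩ := uniq_Q hp.pos α hα h2
  have hn : n = 0 := by
    have : (n : ℚ) = 0 := by linear_combination 2 * b
    exact_mod_cast this
  subst hn
  simpa using a

lemma exists_basis_O {p : ℕ} (hp : p.Prime) (h3 : p % 4 = 3) {K : Type} [Field K] [NumberField K] (α : K) (hα : α ^ 2 = -(p : K))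
    (hgen : IntermediateField.adjoin ℚ {α} = ⊤) {θ : 𝓞 K} (hθ : (θ : K) = (1 + α) / 2) :
    ∃ b : Module.Basis (Fin 2) ℤ (𝓞 K), b 0 = 1 ∧ b 1 = θ := by
  have hli : LinearIndependent ℤ ![(1 : 𝓞 K), θ] := by
    rw [LinearIndependent.pair_iff]
    intro s t h
    apply uniq_O hp α hα hθ
    simpa [Algebra.smul_def] using h
  suffices hs : ⊤ ≤ Submodule.span ℤ (Set.range ![(1 : 𝓞 K), θ]) from
    ⟨Module.Basis.mk hli hs, by simp [Module.Basis.mk_apply], by simp [Module.Basis.mk_apply]⟩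
  rintro x -
  obtain ⟨a, b, rfl⟩ := rep_O hp h3 α hα hgen hθ x
  have : (a : 𝓞 K) + b * θ = a • (1 : 𝓞 K) + b • θ := by simp
  rw [this]
  refine add_mem (Submodule.smul_mem _ _ (Submodule.subset_span ⟨0, rfl⟩)) (Submodule.smul_mem _ _ (Submodule.subset_span ⟨1, rfl⟩))

lemma trace_O {p : ℕ} (hp : p.Prime) {K : Type} [Field K] [NumberField K] (α : K) (hα : α ^ 2 = -(p : K))
    (hgen : IntermediateField.adjoin ℚ {α} = ⊤) {θ : 𝓞 K} (hθ : (θ : K) = (1 + α) / 2) (m n : ℤ) :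
    Algebra.trace ℤ (𝓞 K) (m + n * θ) = 2 * m + n := by
  have h := (norm_trace_Q hp.pos α hα hgen (m + n / 2) (n / 2)).2
  have h2 : (((m : 𝓞 K) + n * θ : 𝓞 K) : K) = ((m + n / 2 : ℚ) : K) + (n / 2 : ℚ) * α := by
    simp [hθ]; field_simp; ring
  rw [← h2, Algebra.trace_localization ℤ (nonZeroDivisors ℤ)] at h
  have : ((Algebra.trace ℤ (𝓞 K) (m + n * θ) : ℤ) : ℚ) = ((2 * m + n : ℤ) : ℚ) := by
    push_cast; rw [← eq_intCast (algebraMap ℤ ℚ), h]; ring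
  exact_mod_cast this

lemma discr_K {p : ℕ} (hp : p.Prime) (h3 : p % 4 = 3) {K : Type} [Field K] [NumberField K] (α : K) (hα : α ^ 2 = -(p : K))
    (hgen : IntermediateField.adjoin ℚ {α} = ⊤) : discr K = -p := by
  obtain ⟨t, ht⟩ : ∃ t, p + 1 = 4 * t := ⟨p / 4 + 1, by omega⟩
  obtain ⟨θ, hθ, hθ2⟩ := exists_theta ht α hα
  obtain ⟨b, h0, h1⟩ := exists_basis_O hp h3 α hα hgen hθ
  rw [← discr_eq_discr K b, Algebra.discr_def]
  have t1 := trace_O hp α hα hgen hθ 1 0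
  have t2 := trace_O hp α hα hgen hθ 0 1
  have t3 := trace_O hp α hα hgen hθ (-(t : ℤ)) 1
  have e : ((-(t : ℤ) : ℤ) : 𝓞 K) + (1 : ℤ) * θ = θ * θ := by
    rw [← sq, hθ2]; push_cast; ring
  rw [e] at t3
  simp only [Int.cast_one, Int.cast_zero, zero_mul, add_zero, one_mul, zero_add] at t1 t2
  rw [Matrix.det_fin_two]
  simp only [Algebra.traceMatrix_apply, Algebra.traceForm_apply, h0, h1, one_mul, mul_one, t1, t2, t3]
  push_cast
  omega

lemma totComplex {p : ℕ} (hp : p.Prime) {K : Type} [Field K] [NumberField K] (α : K) (hα : α ^ 2 = -(p : K)) :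
    IsTotallyComplex K := by
  refine ⟨fun v => ?_⟩
  rw [← InfinitePlace.not_isReal_iff_isComplex]
  intro hv
  have h1 := congrArg (InfinitePlace.embedding_of_isReal hv) hα
  simp only [map_pow, map_neg, map_natCast] at h1
  have : (0 : ℝ) < p := by exact_mod_cast hp.pos
  nlinarith [sq_nonneg (InfinitePlace.embedding_of_isReal hv α)]

lemma nrC {p : ℕ} (hp : p.Prime) {K : Type} [Field K] [NumberField K] (α : K) (hα : α ^ 2 = -(p : K))
    (hgen : IntermediateField.adjoin ℚ {α} = ⊤) : InfinitePlace.nrComplexPlaces K = 1 := by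
  have := totComplex hp α hα
  have h := IsTotallyComplex.finrank (K := K)
  rw [finrank_K hp.pos α hα hgen] at h
  omega

lemma reg_K {p : ℕ} (hp : p.Prime) {K : Type} [Field K] [NumberField K] (α : K) (hα : α ^ 2 = -(p : K))
    (hgen : IntermediateField.adjoin ℚ {α} = ⊤) : Units.regulator K = 1 := by
  classical
  have := totComplex hp α hα
  have h1 := nrC hp α hα hgen
  have h2 := IsTotallyComplex.nrRealPlaces_eq_zero (K := K)
  have h3 : Fintype.card (InfinitePlace K) = 1 := by
    rw [InfinitePlace.card_eq_nrRealPlaces_add_nrComplexPlaces, h1, h2]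
  have hsub : Subsingleton (InfinitePlace K) := Fintype.card_le_one_iff_subsingleton.mp h3.le
  rw [Units.regulator_eq_det']
  have hemp : IsEmpty {w : InfinitePlace K // w ≠ Units.dirichletUnitTheorem.w₀} :=
    ⟨fun w => w.2 (Subsingleton.elim _ _)⟩
  rw [@Matrix.det_isEmpty]; simp

lemma torsion_K {p : ℕ} (hp : p.Prime) (hp3 : 3 < p) (h3 : p % 4 = 3) {K : Type} [Field K] [NumberField K] (α : K) (hα : α ^ 2 = -(p : K))
    (hgen : IntermediateField.adjoin ℚ {α} = ⊤) : Units.torsionOrder K = 2 := by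
  have key : ∀ u : (𝓞 K)ˣ, u = 1 ∨ u = -1 := by
    intro u
    have hN := Units.norm K u
    obtain ⟨m, n, hx⟩ := rep_half hp h3 α hα hgen u
    have h2 : (u : K) = ((m + n / 2 : ℚ) : K) + (n / 2 : ℚ) * α := by
      push_cast; exact hx.trans (by ring)
    have h := (norm_trace_Q hp.pos α hα hgen (m + n / 2) (n / 2)).1
    rw [← h2] at h
    have hp' : (3 : ℚ) < p := by exact_mod_cast hp3
    rw [h, abs_of_nonneg (by positivity)] at hN
    have h4 : (2 * m + n) ^ 2 + p * n ^ 2 = 4 := by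
      have : (((2 * m + n) ^ 2 + p * n ^ 2 : ℤ) : ℚ) = ((4 : ℤ) : ℚ) := by push_cast; linear_combination 4 * hN
      exact_mod_cast this
    have hn : n = 0 := by
      by_contra hn
      have : 0 < n ^ 2 := by positivity
      have : (5 : ℤ) ≤ p := by omega
      nlinarith [sq_nonneg (2 * m + n)]
    subst hn
    have hm : (m - 1) * (m + 1) = 0 := by nlinarith [h4]
    rcases mul_eq_zero.mp hm with hm | hm
    · left
      have : m = 1 := by omega
      subst this
      apply Units.ext; apply RingOfIntegers.ext; rw [hx]; simp
    · right
      have : m = -1 := by omega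
      subst this
      apply Units.ext; apply RingOfIntegers.ext; rw [hx]; simp
  rw [Units.torsionOrder, Nat.card_eq_two_iff]
  refine ⟨1, ⟨-1, neg_one_mem_torsion⟩, ?_, ?_⟩
  · intro h
    have h := congrArg (fun x : Units.torsion K => (((x : (𝓞 K)ˣ) : 𝓞 K) : K)) h
    simp at h
    have h2 : (2 : K) = 0 := by linear_combination h
    exact two_ne_zero h2
  · ext ⟨u, hu⟩
    simp only [Set.mem_insert_iff, Set.mem_singleton_iff, Set.mem_univ, iff_true]
    rcases key u with h | h
    · left; exact Subtype.ext h
    · right; exact Subtype.ext h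

lemma residue_K {p : ℕ} (hp : p.Prime) (hp3 : 3 < p) (h3 : p % 4 = 3) {K : Type} [Field K] [NumberField K] (α : K) (hα : α ^ 2 = -(p : K))
    (hgen : IntermediateField.adjoin ℚ {α} = ⊤) :
    dedekindZeta_residue K = Real.pi * classNumber K / Real.sqrt p := by
  have := totComplex hp α hα
  rw [dedekindZeta_residue_def, nrC hp α hα hgen, IsTotallyComplex.nrRealPlaces_eq_zero, reg_K hp α hα hgen,
    torsion_K hp hp3 h3 α hα hgen, discr_K hp h3 α hα hgen]
  have : |((-(p : ℤ) : ℤ) : ℝ)| = p := by simp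
  rw [this]
  have hs : Real.sqrt p ≠ 0 := by
    have : (0 : ℝ) < p := by exact_mod_cast hp.pos
    positivity
  field_simp
  push_cast; ring

end SB2

section SA3
open NumberField

lemma recip (p q t : ℕ) [Fact p.Prime] [Fact q.Prime] (h3 : p % 4 = 3) (ht : p + 1 = 4 * t) (hpq : q ≠ p) :
    quadraticChar (ZMod p) (q : ZMod p) = 1 ↔ ∃ r : ℤ, (q : ℤ) ∣ r ^ 2 - r + t := by
  have hp2 : p ≠ 2 := by omega
  have hq0 : (q : ZMod p) ≠ 0 := by
    rw [ne_eq, ZMod.natCast_eq_zero_iff, Nat.prime_dvd_prime_iff_eq Fact.out Fact.out]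
    exact hpq.symm
  have hp0 : (p : ZMod q) ≠ 0 := by
    rw [ne_eq, ZMod.natCast_eq_zero_iff, Nat.prime_dvd_prime_iff_eq Fact.out Fact.out]
    exact hpq
  have htz : (p : ℤ) + 1 = 4 * t := by exact_mod_cast ht
  by_cases hq2 : q = 2
  · subst hq2
    rw [quadraticChar_one_iff_isSquare hq0]
    have := ZMod.exists_sq_eq_two_iff (p := p) hp2
    rw [Nat.cast_ofNat, this]
    constructor
    · intro h
      exact ⟨0, by omega⟩
    · rintro ⟨r, hr⟩
      have : (2 : ℤ) ∣ r ^ 2 - r := by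
        rw [show r ^ 2 - r = (r - 1) * (r - 1 + 1) by ring]
        exact (Int.even_mul_succ_self (r - 1)).two_dvd
      push_cast at hr
      omega
  · have hqodd : q % 2 = 1 := (Nat.Prime.eq_two_or_odd Fact.out).resolve_left hq2
    have hl : legendreSym q (-p) = legendreSym p q := by
      rw [← neg_one_mul, legendreSym.mul, legendreSym.at_neg_one hq2]
      have : q % 4 = 1 ∨ q % 4 = 3 := by omega
      rcases this with h | h
      · rw [ZMod.χ₄_nat_one_mod_four h, one_mul]
        exact (legendreSym.quadratic_reciprocity_one_mod_four h hp2).symm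
      · rw [ZMod.χ₄_nat_three_mod_four h, legendreSym.quadratic_reciprocity_three_mod_four h3 h]; ring
    have h1 : quadraticChar (ZMod p) (q : ZMod p) = legendreSym p q := by simp [legendreSym]
    rw [h1, ← hl, legendreSym.eq_one_iff q (by simpa using hp0)]
    have h2 : (2 : ZMod q) ≠ 0 := by
      have : ((2 : ℕ) : ZMod q) ≠ 0 := by
        rw [ne_eq, ZMod.natCast_eq_zero_iff, Nat.prime_dvd_prime_iff_eq Fact.out Nat.prime_two]
        exact hq2
      simpa using this
    have htq : (p : ZMod q) + 1 = 4 * t := by exact_mod_cast congrArg (Nat.cast (R := ZMod q)) ht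
    constructor
    · rintro ⟨s, hs⟩
      push_cast at hs
      obtain ⟨r, hr⟩ := ZMod.intCast_surjective ((1 + s) / 2)
      refine ⟨r, ?_⟩
      rw [← ZMod.intCast_zmod_eq_zero_iff_dvd]
      push_cast
      rw [hr]
      have h4 : (4 : ZMod q) ≠ 0 := by
        rw [show (4 : ZMod q) = 2 * 2 by norm_num]; exact mul_ne_zero h2 h2
      apply mul_left_cancel₀ h4
      field_simp
      linear_combination -hs - htq
    · rintro ⟨r, hr⟩
      rw [← ZMod.intCast_zmod_eq_zero_iff_dvd] at hr
      push_cast at hr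
      refine ⟨2 * r - 1, ?_⟩
      push_cast
      linear_combination -4 * hr - htq

lemma no_norm_q {K : Type} [Field K] [NumberField K] {q t : ℕ} (hq : q.Prime) {θ : 𝓞 K} (hθ2 : θ ^ 2 = θ - (t : 𝓞 K))
    {I : Ideal (𝓞 K)} (hI : Ideal.absNorm I = q) : ∃ r : ℤ, (q : ℤ) ∣ r ^ 2 - r + t := by
  rw [Ideal.absNorm_apply, Submodule.cardQuot_apply] at hI
  have hfin : Finite (𝓞 K ⧸ I) := Nat.finite_of_card_ne_zero (by rw [hI]; exact hq.ne_zero)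
  have := Fintype.ofFinite (𝓞 K ⧸ I)
  rw [Nat.card_eq_fintype_card] at hI
  have e := ZMod.ringEquivOfPrime (𝓞 K ⧸ I) hq hI
  obtain ⟨r, hr⟩ := ZMod.intCast_surjective (e.symm (Ideal.Quotient.mk I θ))
  refine ⟨r, ?_⟩
  rw [← ZMod.intCast_zmod_eq_zero_iff_dvd]
  push_cast
  have h := congrArg (fun x => e.symm (Ideal.Quotient.mk I x)) hθ2
  simp only [map_pow, map_sub, map_natCast] at h
  rw [← hr] at h
  linear_combination h

lemma prime_ideal_of_norm {K : Type} [Field K] [NumberField K] {q : ℕ} (hq : q.Prime) {I : Ideal (𝓞 K)}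
    (hI : Ideal.absNorm I = q) : Prime I := by
  apply Ideal.prime_of_isPrime
  · rintro rfl
    rw [Ideal.absNorm_bot] at hI
    exact hq.ne_zero hI.symm
  · exact Ideal.isPrime_of_irreducible_absNorm (by rw [hI]; exact hq)

lemma count_prime_pow {p : ℕ} [Fact p.Prime] (h3 : p % 4 = 3) {K : Type} [Field K] [NumberField K] (α : K) (hα : α ^ 2 = -(p : K))
    (hgen : IntermediateField.adjoin ℚ {α} = ⊤) (q k : ℕ) (hq : q.Prime) : (idealCount K (q ^ k) : ℤ) =
      ∑ i ∈ Finset.range (k + 1), (quadraticChar (ZMod p) (q : ZMod p)) ^ i := by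
  have hp : p.Prime := Fact.out
  have hqf : Fact q.Prime := ⟨hq⟩
  obtain ⟨t, ht⟩ : ∃ t, p + 1 = 4 * t := ⟨p / 4 + 1, by omega⟩
  obtain ⟨θ, hθ, hθ2⟩ := exists_theta ht α hα
  have htz : (p : ℤ) + 1 = 4 * t := by exact_mod_cast ht
  have hto : (p : 𝓞 K) + 1 = 4 * t := by exact_mod_cast congrArg (Nat.cast (R := 𝓞 K)) ht
  have hNq : ∀ q : ℕ, Ideal.absNorm (Ideal.span {(q : 𝓞 K)}) = q ^ 2 := by
    intro q
    rw [Ideal.absNorm_span_natCast, RingOfIntegers.rank, finrank_K hp.pos α hα hgen]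
  by_cases hpq : q = p
  · subst hpq
    have hP2 : (Ideal.span {2 * θ - 1}) ^ 2 = Ideal.span {(q : 𝓞 K)} := by
      rw [Ideal.span_singleton_pow, ← Ideal.span_singleton_neg]
      congr 2
      linear_combination -4 * hθ2 - hto
    have hN : Ideal.absNorm (Ideal.span {2 * θ - 1}) = q := by
      have h := congrArg Ideal.absNorm hP2
      rw [map_pow, hNq] at h
      exact Nat.pow_left_injective (n := 2) (by norm_num) h
    rw [idealCount_ram K hq k (prime_ideal_of_norm hq hN) hP2 hN]
    simp [zero_pow_eq]
  have hχ : quadraticChar (ZMod p) (q : ZMod p) = 1 ∨ quadraticChar (ZMod p) (q : ZMod p) = -1 := by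
    apply quadraticChar_dichotomy
    rw [ne_eq, ZMod.natCast_eq_zero_iff, Nat.prime_dvd_prime_iff_eq Fact.out Fact.out]
    exact fun h => hpq h.symm
  rcases hχ with hχ | hχ
  · obtain ⟨r, s, hrs⟩ := (recip p q t h3 ht hpq).mp hχ
    have hcop : IsCoprime (q : ℤ) (2 * r - 1) := by
      rw [Prime.coprime_iff_not_dvd (Nat.prime_iff_prime_int.mp hq)]
      rintro ⟨c, hc⟩
      have : (q : ℤ) ∣ p := ⟨4 * s - c * (2 * r - 1), by linear_combination 4 * hrs - (2 * r - 1) * hc + htz⟩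
      rw [Int.natCast_dvd_natCast, Nat.prime_dvd_prime_iff_eq hq hp] at this
      exact hpq this
    obtain ⟨u, v, huv⟩ := hcop
    have huv' : (u : 𝓞 K) * q + v * (2 * r - 1) = 1 := by exact_mod_cast congrArg (Int.cast (R := 𝓞 K)) huv
    have hrs' : (r : 𝓞 K) ^ 2 - r + t = q * s := by exact_mod_cast congrArg (Int.cast (R := 𝓞 K)) hrs
    set P : Ideal (𝓞 K) := Ideal.span {(q : 𝓞 K), θ - r} with hPdef
    set Q : Ideal (𝓞 K) := Ideal.span {(q : 𝓞 K), θ - 1 + r} with hQdef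
    have p1 : (q : 𝓞 K) ∈ P := Ideal.subset_span (by simp)
    have p2 : θ - r ∈ P := Ideal.subset_span (by simp)
    have q1 : (q : 𝓞 K) ∈ Q := Ideal.subset_span (by simp)
    have q2 : θ - 1 + r ∈ Q := Ideal.subset_span (by simp)
    have hPQ : P * Q = Ideal.span {(q : 𝓞 K)} := by
      apply le_antisymm
      · rw [hPdef, hQdef, Ideal.span_pair_mul_span_pair, Ideal.span_le]
        intro x hx
        simp only [Set.mem_insert_iff, Set.mem_singleton_iff] at hx
        simp only [SetLike.mem_coe, Ideal.mem_span_singleton]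
        rcases hx with rfl | rfl | rfl | rfl
        · exact ⟨q, rfl⟩
        · exact ⟨_, rfl⟩
        · exact ⟨θ - r, by ring⟩
        · exact ⟨-s, by linear_combination hθ2 - hrs'⟩
      · rw [Ideal.span_singleton_le_iff_mem]
        have : (q : 𝓞 K) = u * (q * q) + v * (q * (θ - 1 + r) - (θ - r) * q) := by
          linear_combination -(q : 𝓞 K) * huv'
        rw [this]
        exact add_mem (Ideal.mul_mem_left _ _ (Ideal.mul_mem_mul p1 q1)) (Ideal.mul_mem_left _ _
          (sub_mem (Ideal.mul_mem_mul p1 q2) (Ideal.mul_mem_mul p2 q1)))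
    have hnot : ∀ c : ℤ, ¬ θ + c ∈ Ideal.span {(q : 𝓞 K)} := by
      intro c hc
      rw [Ideal.mem_span_singleton] at hc
      obtain ⟨y, hy⟩ := hc
      obtain ⟨m, n, rfl⟩ := rep_O hp h3 α hα hgen hθ y
      have : ((c - q * m : ℤ) : 𝓞 K) + (1 - q * n : ℤ) * θ = 0 := by push_cast; linear_combination hy
      have h5 := (uniq_O hp α hα hθ this).2
      have h6 : (q : ℤ) ∣ 1 := ⟨n, by linear_combination h5⟩
      have h7 : q ∣ 1 := by exact_mod_cast h6
      exact hq.one_lt.ne' (Nat.dvd_one.mp h7)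
    have hPt : P ≠ ⊤ := by
      intro h
      rw [h, Ideal.top_mul] at hPQ
      apply hnot (-1 + r)
      rw [← hPQ]; push_cast; convert q2 using 1; ring
    have hQt : Q ≠ ⊤ := by
      intro h
      rw [h, Ideal.mul_top] at hPQ
      apply hnot (-r)
      rw [← hPQ]; push_cast; convert p2 using 1; ring
    have hne : P ≠ Q := by
      intro h
      apply hPt
      rw [Ideal.eq_top_iff_one, ← huv']
      have : (2 * r - 1 : 𝓞 K) = (θ - 1 + r) - (θ - r) := by ring
      rw [this]
      exact add_mem (Ideal.mul_mem_left _ _ p1) (Ideal.mul_mem_left _ _ (sub_mem (h ▸ q2) p2))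
    have hNN : Ideal.absNorm P * Ideal.absNorm Q = q ^ 2 := by rw [← map_mul, hPQ, hNq]
    have hNP : Ideal.absNorm P = q ∧ Ideal.absNorm Q = q := by
      have h1 : Ideal.absNorm P ≠ 1 := fun h => hPt (Ideal.absNorm_eq_one_iff.mp h)
      have h2 : Ideal.absNorm Q ≠ 1 := fun h => hQt (Ideal.absNorm_eq_one_iff.mp h)
      exact (hq.mul_eq_prime_sq_iff h1 h2).mp hNN
    rw [idealCount_split K hq k (prime_ideal_of_norm hq hNP.1) (prime_ideal_of_norm hq hNP.2) hne hPQ hNP.1 hNP.2, hχ]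
    simp
  · have hno : ∀ I : Ideal (𝓞 K), Ideal.absNorm I ≠ q := by
      intro I hI
      have := (recip p q t h3 ht hpq).mpr (no_norm_q hq hθ2 hI)
      rw [hχ] at this
      norm_num at this
    have hprime : Prime (Ideal.span {(q : 𝓞 K)}) := by
      have hnt : Ideal.span {(q : 𝓞 K)} ≠ ⊤ := by
        intro h
        have := hNq q
        rw [h, Ideal.absNorm_top] at this
        have := hq.one_lt
        nlinarith
      obtain ⟨M, hM, hle⟩ := Ideal.exists_le_maximal _ hnt
      obtain ⟨J, hJ⟩ := Ideal.dvd_iff_le.mpr hle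
      have hNN : Ideal.absNorm M * Ideal.absNorm J = q ^ 2 := by rw [← map_mul, ← hJ, hNq]
      have h1 : Ideal.absNorm M ≠ 1 := fun h => hM.ne_top (Ideal.absNorm_eq_one_iff.mp h)
      have h2 : Ideal.absNorm J = 1 := by
        by_contra h2
        exact hno _ ((hq.mul_eq_prime_sq_iff h1 h2).mp hNN).1
      rw [Ideal.absNorm_eq_one_iff] at h2
      rw [h2, Ideal.mul_top] at hJ
      rw [hJ]
      apply Ideal.prime_of_isPrime _ hM.isPrime
      rintro rfl
      rw [Ideal.absNorm_bot, zero_mul] at hNN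
      exact (pow_ne_zero 2 hq.ne_zero) hNN.symm
    rw [idealCount_inert K hq k hprime (hNq q), hχ, neg_one_geom_sum]
    simp only [Nat.even_add_one]
    split_ifs <;> simp_all

end SA3

section SD
open Polynomial

noncomputable def DX (R : Type) [CommRing R] : R[X] →ₗ[R] R[X] :=
  (LinearMap.mulLeft R (X : R[X])).comp derivative

lemma DX_apply (R : Type) [CommRing R] (f : R[X]) : DX R f = X * derivative f := rfl

lemma DX_pow_X (R : Type) [CommRing R] (n j : ℕ) : ((DX R) ^ n) (X ^ j) = C ((j : R) ^ n) * X ^ j := by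
  induction n with
  | zero => simp
  | succ n ih =>
    rw [pow_succ', Module.End.mul_apply, ih, DX_apply, derivative_C_mul, derivative_X_pow]
    rcases j with _ | j
    · simp
    · simp only [Nat.add_sub_cancel, pow_succ, C_mul]; ring

lemma DX_pow_key (R : Type) [CommRing R] (n : ℕ) : ∀ V : R[X],
    (((DX R) ^ n) ((X - 1) ^ n * V)).eval 1 = n.factorial * V.eval 1 := by
  induction n with
  | zero => intro V; simp
  | succ n ih =>
    intro V
    have : DX R ((X - 1) ^ (n + 1) * V) = (X - 1) ^ n * ((n + 1 : R[X]) * X * V + (X - 1) * (X * derivative V)) := by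
      rw [DX_apply, derivative_mul, derivative_pow]
      simp; ring
    rw [pow_succ, Module.End.mul_apply, this, ih, Nat.factorial_succ]
    simp; ring

lemma fact_prod (m : ℕ) : m.factorial * ∏ k ∈ Finset.range m, (2 * (2 * k + 1)) = (2 * m).factorial := by
  induction m with
  | zero => simp
  | succ m ih =>
    rw [Finset.prod_range_succ, Nat.factorial_succ, show 2 * (m + 1) = 2 * m + 1 + 1 by ring, Nat.factorial_succ,
      Nat.factorial_succ, ← ih]
    ring

noncomputable def Pi1 (R : Type) [CommRing R] (p m : ℕ) : R[X] :=
  ∏ k ∈ Finset.range m, (X ^ (2 * k + 1) - X ^ (p - (2 * k + 1)))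

noncomputable def G1 (p : ℕ) [Fact p.Prime] (R : Type) [CommRing R] : R[X] :=
  ∑ a : ZMod p, C ((quadraticChar (ZMod p) a : ℤ) : R) * X ^ a.val

lemma Pi1_D (p m : ℕ) [Fact p.Prime] (hm : p = 2 * m + 1) :
    (((DX (ZMod p)) ^ m) (Pi1 (ZMod p) p m)).eval 1 = -1 := by
  have : Pi1 (ZMod p) p m = (X - 1) ^ m * ∏ k ∈ Finset.range m,
      ((∑ i ∈ Finset.range (2 * k + 1), X ^ i) - ∑ i ∈ Finset.range (p - (2 * k + 1)), X ^ i) := by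
    rw [Pi1]
    have h : (X - 1 : (ZMod p)[X]) ^ m = ∏ k ∈ Finset.range m, (X - 1) := by simp
    rw [h, ← Finset.prod_mul_distrib]
    refine Finset.prod_congr rfl fun k _ => ?_
    rw [mul_sub, mul_geom_sum, mul_geom_sum]; ring
  rw [this, DX_pow_key, eval_prod]
  have h2 : ∀ k ∈ Finset.range m, eval (1 : ZMod p)
      ((∑ i ∈ Finset.range (2 * k + 1), X ^ i) - ∑ i ∈ Finset.range (p - (2 * k + 1)), X ^ i) = ((2 * (2 * k + 1) : ℕ) : ZMod p) := by
    intro k hk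
    rw [Finset.mem_range] at hk
    simp only [eval_sub, eval_finsetSum, eval_pow, eval_X, one_pow, Finset.sum_const, Finset.card_range, nsmul_eq_mul, mul_one]
    rw [Nat.cast_sub (by omega), CharP.cast_eq_zero (ZMod p) p]
    push_cast; ring
  rw [Finset.prod_congr rfl h2, ← Nat.cast_prod, ← Nat.cast_mul, fact_prod]
  rw [← ZMod.wilsons_lemma p]
  congr 2; omega

lemma G1_D (p m : ℕ) [Fact p.Prime] (hp2 : p ≠ 2) (hm : p = 2 * m + 1) :
    (((DX (ZMod p)) ^ m) (G1 p (ZMod p))).eval 1 = -1 := by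
  rw [G1, map_sum, eval_finsetSum]
  have h : ∀ a : ZMod p, eval 1 (((DX (ZMod p)) ^ m) (C ((quadraticChar (ZMod p) a : ℤ) : ZMod p) * X ^ a.val)) = 
     1 - if a = 0 then 1 else 0 := by
    intro a
    rw [← smul_eq_C_mul, map_smul, DX_pow_X, quadraticChar_eq_pow_of_char_ne_two' (by rwa [ZMod.ringChar_zmod_n]), ZMod.card]
    simp only [ZMod.natCast_val, ZMod.cast_id', id, eval_smul, eval_mul, eval_C, eval_pow, eval_X, one_pow, mul_one, smul_eq_mul]
    rw [show p / 2 = m by omega, ← pow_add, show m + m = p - 1 by omega]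
    split_ifs with ha
    · rw [ha, zero_pow (by have := (Fact.out : p.Prime).two_le; omega)]; simp
    · rw [ZMod.pow_card_sub_one_eq_one ha]; simp
  rw [Finset.sum_congr rfl (fun a _ => h a)]
  simp

lemma not_neg (p m : ℕ) [Fact p.Prime] (hp2 : p ≠ 2) (hm : p = 2 * m + 1) {ζ : ℂ} (hζ : IsPrimitiveRoot ζ p) :
    aeval ζ (G1 p ℤ) ≠ - aeval ζ (Pi1 ℤ p m) := by
  intro h
  have hp : p.Prime := Fact.out
  have h0 : aeval ζ (G1 p ℤ + Pi1 ℤ p m) = 0 := by rw [map_add, h]; ring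
  have hd := minpoly.isIntegrallyClosed_dvd (hζ.isIntegral hp.pos) h0
  rw [← cyclotomic_eq_minpoly hζ hp.pos] at hd
  have hd2 := Polynomial.map_dvd (Int.castRingHom (ZMod p)) hd
  have hG : (G1 p ℤ).map (Int.castRingHom (ZMod p)) = G1 p (ZMod p) := by
    simp [G1, Polynomial.map_sum]
  have hP : (Pi1 ℤ p m).map (Int.castRingHom (ZMod p)) = Pi1 (ZMod p) p m := by
    simp [Pi1, Polynomial.map_prod]
  rw [map_cyclotomic, Polynomial.map_add, hG, hP] at hd2
  have hc := cyclotomic_mul_prime_eq_pow_of_not_dvd (ZMod p) (p := p) (n := 1) (by simpa using hp.one_lt.ne')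
  rw [one_mul, cyclotomic_one] at hc
  rw [hc] at hd2
  have hm1 : 1 ≤ m := by have := hp.two_le; omega
  have hd3 : (X - 1 : (ZMod p)[X]) ^ (m + 1) ∣ G1 p (ZMod p) + Pi1 (ZMod p) p m :=
    (pow_dvd_pow _ (by omega)).trans hd2
  obtain ⟨W, hW⟩ := hd3
  have h1 : (((DX (ZMod p)) ^ m) (G1 p (ZMod p) + Pi1 (ZMod p) p m)).eval 1 = 0 := by
    rw [hW, pow_succ, mul_assoc, DX_pow_key]; simp
  rw [map_add, eval_add, G1_D p m hp2 hm, Pi1_D p m hm] at h1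
  have h2 : ((2 : ℕ) : ZMod p) = 0 := by push_cast; linear_combination -h1
  rw [ZMod.natCast_eq_zero_iff, Nat.prime_dvd_prime_iff_eq hp Nat.prime_two] at h2
  exact hp2 h2

lemma prod_range_two_mul {M : Type} [CommMonoid M] (F : ℕ → M) (m : ℕ) :
    ∏ k ∈ Finset.range (2 * m), F k = ∏ k ∈ Finset.range m, (F (2 * k) * F (2 * k + 1)) := by
  induction m with
  | zero => simp
  | succ m ih => rw [show 2 * (m + 1) = 2 * m + 1 + 1 by ring, Finset.prod_range_succ, Finset.prod_range_succ, ih,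
      Finset.prod_range_succ, mul_assoc]

lemma Pi1_sq (p m : ℕ) (hm : p = 2 * m + 1) {ζ : ℂ} (hζ : IsPrimitiveRoot ζ p) :
    (-1) ^ m * (aeval ζ (Pi1 ℤ p m)) ^ 2 = (p : ℂ) := by
  have hω : IsPrimitiveRoot (ζ ^ 2) p := hζ.pow_of_coprime 2 (by rw [hm]; simp)
  rw [hm] at hω
  have h := hω.prod_one_sub_pow_eq_order
  rw [prod_range_two_mul, Finset.prod_mul_distrib, 
    ← Finset.prod_range_reflect (fun k => 1 - (ζ ^ 2) ^ (2 * k + 1 + 1)), ← Finset.prod_mul_distrib] at h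
  have h1 : (p : ℂ) = ((2 * m : ℕ) : ℂ) + 1 := by rw [hm]; push_cast; ring
  rw [h1, ← h, Pi1, map_prod, ← Finset.prod_pow, ← Finset.card_range m, ← Finset.prod_const, Finset.card_range,
    ← Finset.prod_mul_distrib]
  refine Finset.prod_congr rfl fun k hk => ?_
  rw [Finset.mem_range] at hk
  simp only [map_sub, map_pow, aeval_X]
  have e : 2 * (m - 1 - k) + 1 + 1 = p - (2 * k + 1) := by omega
  rw [e]
  have e2 : ζ ^ (2 * k + 1) * ζ ^ (p - (2 * k + 1)) = 1 := by
    rw [← pow_add, show 2 * k + 1 + (p - (2 * k + 1)) = p by omega, hζ.pow_eq_one]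
  have e3 : ∀ n : ℕ, (ζ ^ 2) ^ n = (ζ ^ n) ^ 2 := fun n => by rw [← pow_mul, ← pow_mul, mul_comm]
  rw [e3, e3]
  generalize ζ ^ (2 * k + 1) = x at *
  generalize ζ ^ (p - (2 * k + 1)) = y at *
  linear_combination (1 - x * y) * e2

lemma Pi1_sign (p s : ℕ) (hs : p = 4 * s + 3) :
    ∃ c : ℝ, 0 < c ∧ aeval (Complex.exp (2 * Real.pi * Complex.I / p)) (Pi1 ℤ p (2 * s + 1)) = c * Complex.I := by
  set ζ := Complex.exp (2 * Real.pi * Complex.I / p) with hζ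
  have hp0 : (0 : ℝ) < p := by rw [hs]; positivity
  have hpc : (p : ℂ) ≠ 0 := by exact_mod_cast hp0.ne'
  have hterm : ∀ k, k < 2 * s + 1 → ζ ^ (2 * k + 1) - ζ ^ (p - (2 * k + 1)) =
      2 * Complex.I * ((Real.sin (2 * Real.pi * (2 * k + 1) / p) : ℝ) : ℂ) := by
    intro k hk
    rw [hζ, ← Complex.exp_nat_mul, ← Complex.exp_nat_mul, Nat.cast_sub (by omega)]
    have e1 : ((2 * k + 1 : ℕ) : ℂ) * (2 * Real.pi * Complex.I / p) =
      ((2 * Real.pi * (2 * k + 1) / p : ℝ) : ℂ) * Complex.I := by push_cast; ring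
    have e2 : ((p : ℂ) - (2 * k + 1 : ℕ)) * (2 * Real.pi * Complex.I / p) =
      -((2 * Real.pi * (2 * k + 1) / p : ℝ) : ℂ) * Complex.I + 2 * Real.pi * Complex.I := by
      push_cast; field_simp; ring
    rw [e1, e2, Complex.exp_periodic, Complex.exp_mul_I, Complex.exp_mul_I, Complex.cos_neg, Complex.sin_neg,
      ← Complex.ofReal_sin]
    ring
  have hA : ∀ k, k < s + 1 → 0 < Real.sin (2 * Real.pi * (2 * k + 1) / p) := by
    intro k hk
    apply Real.sin_pos_of_pos_of_lt_pi
    · have := Real.pi_pos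
      positivity
    · rw [div_lt_iff₀ hp0]
      have h1 : (2 * (2 * k + 1) : ℝ) < p := by
        have : 2 * (2 * k + 1) < p := by omega
        exact_mod_cast this
      nlinarith [Real.pi_pos]
  have hB : ∀ k, k < s → 0 < - Real.sin (2 * Real.pi * (2 * (s + 1 + k : ℕ) + 1) / p) := by
    intro k hk
    rw [← Real.sin_sub_pi]
    apply Real.sin_pos_of_pos_of_lt_pi
    · have h1 : (p : ℝ) < 2 * (2 * (s + 1 + k : ℕ) + 1) := by
        have : p < 2 * (2 * (s + 1 + k) + 1) := by omega
        exact_mod_cast this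
      rw [sub_pos, lt_div_iff₀ hp0]
      nlinarith [Real.pi_pos]
    · have h1 : (2 * (2 * (s + 1 + k : ℕ) + 1) : ℝ) < 2 * p := by
        have : 2 * (2 * (s + 1 + k) + 1) < 2 * p := by omega
        exact_mod_cast this
      rw [sub_lt_iff_lt_add, div_lt_iff₀ hp0]
      nlinarith [Real.pi_pos]
  refine ⟨2 ^ (2 * s + 1) * ((∏ k ∈ Finset.range (s + 1), Real.sin (2 * Real.pi * (2 * k + 1) / p)) *
    ∏ k ∈ Finset.range s, (- Real.sin (2 * Real.pi * (2 * (s + 1 + k : ℕ) + 1) / p))), ?_, ?_⟩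
  · have h1 := Finset.prod_pos (fun k hk => hA k (Finset.mem_range.mp hk))
    have h2 := Finset.prod_pos (fun k hk => hB k (Finset.mem_range.mp hk))
    positivity
  · rw [Pi1, map_prod]
    simp only [map_sub, map_pow, aeval_X]
    rw [Finset.prod_congr rfl (fun k hk => hterm k (Finset.mem_range.mp hk)), Finset.prod_mul_distrib,
      Finset.prod_const, Finset.card_range, ← Complex.ofReal_prod,
      show Finset.range (2 * s + 1) = Finset.range ((s + 1) + s) by congr 1; ring, Finset.prod_range_add,
      Finset.prod_neg, Finset.card_range, mul_pow, show Complex.I ^ (2 * s + 1) = (-1) ^ s * Complex.I by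
        rw [pow_succ, pow_mul, Complex.I_sq]]
    push_cast
    have h4 : ((-1 : ℂ) ^ s) * (-1) ^ s = 1 := by rw [← mul_pow]; simp
    ring

lemma gauss_sign (p : ℕ) [Fact p.Prime] (h3 : p % 4 = 3) :
    gaussSum (chiC p) ZMod.stdAddChar = Real.sqrt p * Complex.I := by
  have hp : p.Prime := Fact.out
  have hp2 : p ≠ 2 := by omega
  obtain ⟨s, hs⟩ : ∃ s, p = 4 * s + 3 := ⟨p / 4, by omega⟩
  set ζ := Complex.exp (2 * Real.pi * Complex.I / p) with hζ
  have hζp : IsPrimitiveRoot ζ p := Complex.isPrimitiveRoot_exp p hp.ne_zero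
  have hm : p = 2 * (2 * s + 1) + 1 := by omega
  have hg : gaussSum (chiC p) ZMod.stdAddChar = aeval ζ (G1 p ℤ) := by
    rw [gaussSum, G1, map_sum]
    refine Finset.sum_congr rfl fun a _ => ?_
    rw [chiC_apply, ZMod.stdAddChar_apply, ZMod.toCircle_apply, map_mul, aeval_C, map_pow, aeval_X, hζ,
      ← Complex.exp_nat_mul]
    simp only [algebraMap_int_eq, eq_intCast, Int.cast_id]
    congr 2
    ring
  have hg2 := gaussSum_sq (chiC_ne_one p hp2) (MulChar.IsQuadratic.comp (quadraticChar_isQuadratic _) _ : (chiC p).IsQuadratic)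
    (ZMod.isPrimitive_stdAddChar p)
  have hP2 := Pi1_sq p _ hm hζp
  rw [chiC_neg p hp2 h3, map_one, ZMod.card] at hg2
  rw [Odd.neg_one_pow ⟨s, rfl⟩] at hP2
  have hne := not_neg p _ hp2 hm hζp
  rw [← hg] at hne
  have heq : gaussSum (chiC p) ZMod.stdAddChar = aeval ζ (Pi1 ℤ p (2 * s + 1)) := by
    have : gaussSum (chiC p) ZMod.stdAddChar ^ 2 = (aeval ζ (Pi1 ℤ p (2 * s + 1))) ^ 2 := by
      rw [hg2]; linear_combination hP2
    exact (sq_eq_sq_iff_eq_or_eq_neg.mp this).resolve_right hne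
  obtain ⟨c, hc, hcP⟩ := Pi1_sign p s hs
  rw [heq, hcP]
  rw [← hζ] at hcP
  rw [hcP, mul_pow, Complex.I_sq] at hP2
  have hc2 : c ^ 2 = p := by
    have : ((c ^ 2 : ℝ) : ℂ) = ((p : ℝ) : ℂ) := by push_cast; linear_combination hP2
    exact_mod_cast this
  rw [← hc2, Real.sqrt_sq hc.le]

end SD
lemma class_eq (p : ℕ) [Fact p.Prime] (hp3 : 3 < p) (h3 : p % 4 = 3) (K : Type) [Field K] [NumberField K] (α : K)
    (hα : α ^ 2 = -(p : K)) (hgen : IntermediateField.adjoin ℚ {α} = ⊤) :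
    (NumberField.classNumber K : ℚ) = - (chiSum p : ℚ) / p := by
  have hp : p.Prime := Fact.out
  have hp2 : p ≠ 2 := by omega
  have h1 := L_one_eq_residue p hp2 K (idealCount_eq_of_prime_pow p K (fun q k hq => count_prime_pow h3 α hα hgen q k hq))
  have h2 := L_one p hp2 h3
  rw [h1, gauss_sign p h3, residue_K hp hp3 h3 α hα hgen] at h2
  have hs : ((Real.sqrt p : ℝ) : ℂ) ≠ 0 := by
    have : (0 : ℝ) < p := by exact_mod_cast hp.pos
    have : 0 < Real.sqrt p := by positivity
    exact_mod_cast this.ne'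
  have hpi : ((Real.pi : ℝ) : ℂ) ≠ 0 := by exact_mod_cast Real.pi_ne_zero
  have hpc : (p : ℂ) ≠ 0 := by exact_mod_cast hp.ne_zero
  have hI := Complex.I_ne_zero
  have h5 : ((NumberField.classNumber K : ℚ) : ℂ) = ((- (chiSum p : ℚ) / p : ℚ) : ℂ) := by
    have h6 : (Real.pi * Complex.I : ℂ) * (NumberField.classNumber K) = (Real.pi * Complex.I) * (-(chiSum p : ℂ) / p) := by
      have h7 : ((Real.sqrt p : ℝ) : ℂ) * Complex.I * ((Real.pi * NumberField.classNumber K / Real.sqrt p : ℝ) : ℂ) =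
        (Real.pi * Complex.I : ℂ) * (NumberField.classNumber K) := by push_cast; field_simp
      rw [← h7, h2]; ring
    have := mul_left_cancel₀ (mul_ne_zero hpi hI) h6
    push_cast; exact this
  exact_mod_cast h5


/-- For a prime `p > 3` and `h_p` the class number of the imaginary
quadratic field `ℚ(√-p)` (a number field `K` generated over `ℚ` by a square root `α`
of `-p`): `∑_{x=1}^{p-1} {-x²/p} = (p-1)/2` if `p ≡ 1 (mod 4)`, and
`∑_{x=1}^{p-1} {-x²/p} = (p-1)/2 + h_p` if `p ≡ 3 (mod 4)`. -/
theorem sum_fract_neg_sq_div_prime_classNumber (p : ℕ) (hp : p.Prime) (hp3 : 3 < p)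
    (K : Type) [Field K] [NumberField K] (α : K) (hα : α ^ 2 = -(p : K))
    (hgen : IntermediateField.adjoin ℚ {α} = ⊤) :
    (p % 4 = 1 →
      ∑ x ∈ Finset.Icc 1 (p - 1), Int.fract (-(x : ℚ) ^ 2 / (p : ℚ)) =
        ((p : ℚ) - 1) / 2) ∧
    (p % 4 = 3 →
      ∑ x ∈ Finset.Icc 1 (p - 1), Int.fract (-(x : ℚ) ^ 2 / (p : ℚ)) =
        ((p : ℚ) - 1) / 2 + (NumberField.classNumber K : ℚ)) := by
  have hf : Fact p.Prime := ⟨hp⟩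
  have hp2 : p ≠ 2 := by omega
  constructor
  · intro h
    rw [sum_main p hp2, chiSum_symm p hp2 h]; simp
  · intro h
    rw [sum_main p hp2, quad_neg_one_three p hp2 h, class_eq p hp3 h K α hα hgen]
    push_cast; ring
end

section
/- Let p be a prime with p ≡ 3 (mod 4). Then ∑_{0 < a < 4p, a odd} (−1)^{(a−1)/2} (a|p) · a = 0; equivalently, h_p' := −∑_{0 < a < 4p, a odd} (−1)^{(a−1)/2} (a|p) · (a/(4p)) = 0. -/
/-- `h_p' = -∑_{0<a<4p, a odd} (-1)^((a-1)/2)·(a|p)·(a/(4p))`. -/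
def hpPrime (p : ℕ) [Fact p.Prime] : ℚ :=
  -∑ a ∈ (Finset.range (4 * p)).filter (fun a => Odd a),
      (-1 : ℚ) ^ ((a - 1) / 2) * (legendreSym p a : ℚ) * ((a : ℚ) / (4 * p))

theorem sum_odd_aux (F : ℕ → ℤ) (n : ℕ) :
    ∑ a ∈ (Finset.range (2 * n)).filter (fun a => Odd a), F a
      = ∑ k ∈ Finset.range n, F (2 * k + 1) := by
  rw [Finset.sum_filter]
  induction n with
  | zero => simp
  | succ n ih =>
    rw [show 2 * (n + 1) = 2 * n + 1 + 1 by ring, Finset.sum_range_succ, Finset.sum_range_succ, ih,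
      Finset.sum_range_succ]
    simp

theorem int_part_aux (p : ℕ) [Fact p.Prime] (hp : p % 4 = 3) :
    ∑ a ∈ (Finset.range (4 * p)).filter (fun a => Odd a),
        (-1 : ℤ) ^ ((a - 1) / 2) * legendreSym p a * (a : ℤ) = 0 := by
  have hodd : Odd p := Nat.odd_iff.mpr (by omega)
  rw [show 4 * p = 2 * (2 * p) by ring,
    sum_odd_aux (fun a => (-1 : ℤ) ^ ((a - 1) / 2) * legendreSym p a * (a : ℤ))]
  obtain ⟨g, hg⟩ : ∃ g : ℕ → ℤ, ∀ k, g k = (-1 : ℤ) ^ k * legendreSym p ((2 * k + 1 : ℕ) : ℤ) :=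
    ⟨_, fun _ => rfl⟩
  have e : ∀ k : ℕ, (-1 : ℤ) ^ ((2 * k + 1 - 1) / 2) * legendreSym p ((2 * k + 1 : ℕ) : ℤ)
      * ((2 * k + 1 : ℕ) : ℤ) = g k * (2 * k + 1) := by
    intro k
    rw [hg, show (2 * k + 1 - 1) / 2 = k by omega]
    push_cast
    ring
  simp only [e]
  have h1 : ∀ k, g (p + k) = - g k := by
    intro k
    rw [hg, hg, pow_add, hodd.neg_one_pow]
    have : legendreSym p ((2 * (p + k) + 1 : ℕ) : ℤ) = legendreSym p ((2 * k + 1 : ℕ) : ℤ) := by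
      unfold legendreSym
      congr 1
      push_cast
      simp
    rw [this]; ring
  have h2 : ∀ k ∈ Finset.range (2 * p), g (2 * p - 1 - k) = g k := by
    intro k hk
    rw [Finset.mem_range] at hk
    obtain ⟨m, hm⟩ : ∃ m, 2 * p = m + k + 1 := ⟨2 * p - 1 - k, by omega⟩
    have hmk : 2 * p - 1 - k = m := by omega
    rw [hmk, hg, hg]
    have hL : legendreSym p ((2 * m + 1 : ℕ) : ℤ) = - legendreSym p ((2 * k + 1 : ℕ) : ℤ) := by
      have h4 : ((2 * m + 1 : ℕ) : ℤ) = -1 * ((2 * k + 1 : ℕ) : ℤ) + 4 * p := by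
        have : (2 * p : ℤ) = m + k + 1 := by exact_mod_cast hm
        push_cast
        linarith
      have h5 : legendreSym p (-1) = -1 := by
        rw [legendreSym.at_neg_one (by omega), ZMod.χ₄_nat_three_mod_four hp]
      have h6 : legendreSym p ((2 * m + 1 : ℕ) : ℤ)
          = legendreSym p (-1 * ((2 * k + 1 : ℕ) : ℤ)) := by
        rw [h4]
        unfold legendreSym
        congr 1
        push_cast
        simp
      rw [h6, legendreSym.mul, h5]; ring
    have hs : (-1 : ℤ) ^ m = - (-1) ^ k := by
      rcases Nat.even_or_odd k with h | h
      · have : Odd m := by grind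
        rw [this.neg_one_pow, h.neg_one_pow]
      · have : Even m := by grind
        rw [this.neg_one_pow, h.neg_one_pow]; rfl
    rw [hL, hs]; ring
  have hT : ∑ k ∈ Finset.range (2 * p), g k = 0 := by
    rw [two_mul, Finset.sum_range_add]
    simp [h1]
  have hr := Finset.sum_range_reflect (fun k : ℕ => g k * (2 * (k : ℤ) + 1)) (2 * p)
  have hr2 : ∑ k ∈ Finset.range (2 * p), g (2 * p - 1 - k) * (2 * ((2 * p - 1 - k : ℕ) : ℤ) + 1)
      = ∑ k ∈ Finset.range (2 * p), (4 * p * g k - g k * (2 * (k : ℤ) + 1)) := by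
    refine Finset.sum_congr rfl fun k hk => ?_
    rw [h2 k hk]
    rw [Finset.mem_range] at hk
    have : ((2 * p - 1 - k : ℕ) : ℤ) = 2 * p - 1 - k := by omega
    rw [this]; ring
  rw [hr2, Finset.sum_sub_distrib, ← Finset.mul_sum, hT] at hr
  linarith

/-- For a prime `p ≡ 3 (mod 4)`,
`∑_{0<a<4p, a odd} (-1)^((a-1)/2)·(a|p)·a = 0`; equivalently, `h_p' = 0`. -/
theorem twisted_legendre_weighted_sum_eq_zero (p : ℕ) [Fact p.Prime] (hp : p % 4 = 3) :
    (∑ a ∈ (Finset.range (4 * p)).filter (fun a => Odd a),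
        (-1 : ℤ) ^ ((a - 1) / 2) * legendreSym p a * (a : ℤ) = 0) ∧ hpPrime p = 0 := by
  have h := int_part_aux p hp
  refine ⟨h, ?_⟩
  have hq := congrArg (fun z : ℤ => (z : ℚ)) h
  push_cast at hq
  unfold hpPrime
  simp only [← mul_div_assoc]
  rw [← Finset.sum_div, hq]
  simp
end

section
/- Let p be a prime with p ≡ 1 (mod 4). Then −∑_{0 < a < 4p, a odd} (−1)^{(a−1)/2} (a|p) · (a/(4p)) = 2 · ∑_{a=1}^{(p−1)/4} (a|p); that is, h_p' = 2 · ∑_{a=1}^{(p−1)/4} (a|p). -/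
theorem aux_sum_zero (p : ℕ) [Fact p.Prime] (hp : p % 4 = 1) :
    ∑ a ∈ Finset.range p, (legendreSym p a : ℚ) = 0 := by
  have h1 : ringChar (ZMod p) ≠ 2 := by
    rw [ZMod.ringChar_zmod_n]; omega
  have h := quadraticChar_sum_zero h1
  have h2 : ∑ a ∈ Finset.range p, legendreSym p a = ∑ a : ZMod p, quadraticChar (ZMod p) a := by
    refine Finset.sum_bij' (fun a _ => (a : ZMod p)) (fun z _ => z.val) ?_ ?_ ?_ ?_ ?_
    · simp
    · intro a _; simpa using ZMod.val_lt a
    · intro a ha; exact ZMod.val_cast_of_lt (by simpa using ha)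
    · intro a _; simp
    · intro a _; simp [legendreSym]
  exact_mod_cast h2.trans h

theorem aux_four (p : ℕ) (f : ℕ → ℚ) : ∑ a ∈ Finset.range (4 * p), f a =
    ∑ a ∈ Finset.range p, (f a + f (a + p) + f (a + 2 * p) + f (a + 3 * p)) := by
  rw [show 4 * p = p + p + p + p by ring]
  simp only [Finset.sum_range_add, Finset.sum_add_distrib]
  congr 1
  · congr 1
    · congr 1
      exact Finset.sum_congr rfl fun x _ => congrArg f (by ring)
    · exact Finset.sum_congr rfl fun x _ => congrArg f (by ring)
  · exact Finset.sum_congr rfl fun x _ => congrArg f (by ring)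

theorem aux_sign (a : ℕ) : (if Odd a then (-1 : ℚ) ^ ((a - 1) / 2) else 0) =
    if a % 4 = 1 then 1 else if a % 4 = 3 then -1 else 0 := by
  split_ifs with h1 h2 h3 h3 h4
  · exact Even.neg_one_pow (by rw [Nat.even_iff]; omega)
  · exact Odd.neg_one_pow (by rw [Nat.odd_iff]; omega)
  all_goals first | rfl | (rw [Nat.odd_iff] at h1; omega)

theorem aux_per (p : ℕ) [Fact p.Prime] (a k : ℕ) :
    legendreSym p ((a + k * p : ℕ) : ℤ) = legendreSym p a := by
  simp [legendreSym]

theorem aux_refl (p : ℕ) [Fact p.Prime] (hp : p % 4 = 1) (a : ℕ) (h : a ≤ p) :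
    legendreSym p ((p - a : ℕ) : ℤ) = legendreSym p a := by
  have h0 : legendreSym p (-1) = 1 := by
    rw [legendreSym.at_neg_one (by omega), ZMod.χ₄_nat_one_mod_four hp]
  have h1 : legendreSym p ((p - a : ℕ) : ℤ) = legendreSym p (-1 * a) := by
    simp [legendreSym, Nat.cast_sub h]
  rw [h1, legendreSym.mul, h0, one_mul]

theorem aux_p (p : ℕ) [Fact p.Prime] : legendreSym p (p : ℤ) = 0 := by
  simp [legendreSym]

theorem aux_swap (p : ℕ) [Fact p.Prime] (hp : p % 4 = 1) :
    ∑ a ∈ Finset.range p, (if a % 4 = 1 then (legendreSym p a : ℚ) else 0) =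
    ∑ a ∈ Finset.range p, (if a % 4 = 0 then (legendreSym p a : ℚ) else 0) := by
  have e1 := Finset.sum_range_succ (fun a : ℕ => if a % 4 = 1 then (legendreSym p a : ℚ) else 0) p
  have e0 := Finset.sum_range_succ (fun a : ℕ => if a % 4 = 0 then (legendreSym p a : ℚ) else 0) p
  simp only [aux_p, Int.cast_zero, ite_self, add_zero] at e0 e1
  rw [← e0, ← e1, ← Finset.sum_range_reflect]
  refine Finset.sum_congr rfl fun a ha => ?_
  have ha' : a ≤ p := by simp at ha; omega
  rw [show p + 1 - 1 - a = p - a by omega, aux_refl p hp a ha']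
  refine if_congr ?_ rfl rfl
  omega

theorem aux_quarter (p : ℕ) [Fact p.Prime] (hp : p % 4 = 1) :
    ∑ a ∈ Finset.range p, (if a % 4 = 0 then (legendreSym p a : ℚ) else 0) =
    ∑ a ∈ Finset.Icc 1 ((p - 1) / 4), (legendreSym p a : ℚ) := by
  have h4 : legendreSym p 4 = 1 := by
    have : ((2 : ℤ) : ZMod p) ≠ 0 := by
      intro h
      rw [ZMod.intCast_zmod_eq_zero_iff_dvd] at h
      have h' : p ∣ 2 := by exact_mod_cast h
      have := Nat.le_of_dvd (by norm_num) h'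
      have := (Fact.out : p.Prime).two_le
      omega
    simpa using legendreSym.sq_one' p this
  rw [← Finset.sum_filter]
  symm
  have hz : ∑ a ∈ Finset.Icc 1 ((p - 1) / 4), (legendreSym p a : ℚ) =
     ∑ a ∈ Finset.range ((p - 1) / 4 + 1), (legendreSym p a : ℚ) := by
    refine Finset.sum_subset (fun x hx => by simp at hx ⊢; omega) ?_
    intro x hx hx'
    have : x = 0 := by simp at hx hx'; omega
    subst this; simp [legendreSym]
  rw [hz]
  refine Finset.sum_bij' (fun a _ => 4 * a) (fun a _ => a / 4) ?_ ?_ ?_ ?_ ?_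
  · intro a ha; simp at ha ⊢; omega
  · intro a ha; simp at ha ⊢; omega
  · intro a ha; simp
  · intro a ha; simp at ha ⊢; omega
  · intro a ha; push_cast; rw [legendreSym.mul, h4, one_mul]

theorem hpPrime_eq_two_mul_sum_legendre (p : ℕ) [Fact p.Prime] (hp : p % 4 = 1) :
    hpPrime p = 2 * ∑ a ∈ Finset.Icc 1 ((p - 1) / 4), (legendreSym p a : ℚ) := by
  have hp0 : (p : ℚ) ≠ 0 := by
    have := (Fact.out : p.Prime).ne_zero
    exact_mod_cast this
  have key : ∀ a : ℕ, (if Odd a then (-1 : ℚ) ^ ((a - 1) / 2) * (legendreSym p a : ℚ) *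
      ((a : ℚ) / (4 * p)) else 0) = (if a % 4 = 1 then 1 else if a % 4 = 3 then -1 else 0) *
      (legendreSym p a : ℚ) * ((a : ℚ) / (4 * p)) := by
    intro a
    rw [← aux_sign]
    split_ifs <;> simp
  rw [hpPrime, Finset.sum_filter, Finset.sum_congr rfl (fun a _ => key a), aux_four]
  refine (congrArg Neg.neg (Finset.sum_congr (g := fun a : ℕ => (1 / 2 : ℚ) * (legendreSym p a : ℚ)
      - (if a % 4 = 1 then (legendreSym p a : ℚ) else 0)
      - (if a % 4 = 0 then (legendreSym p a : ℚ) else 0)) rfl fun a _ => ?_)).trans ?_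
  · have q1 := aux_per p a 1
    rw [one_mul] at q1
    rw [q1, aux_per p a 2, aux_per p a 3]
    have m1 : (a + p) % 4 = (a + 1) % 4 := by omega
    have m2 : (a + 2 * p) % 4 = (a + 2) % 4 := by omega
    have m3 : (a + 3 * p) % 4 = (a + 3) % 4 := by omega
    rw [m1, m2, m3]
    have : a % 4 = 0 ∨ a % 4 = 1 ∨ a % 4 = 2 ∨ a % 4 = 3 := by omega
    rcases this with h | h | h | h <;> simp [h, Nat.add_mod] <;> field_simp <;> ring
  rw [Finset.sum_sub_distrib, Finset.sum_sub_distrib,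
    ← Finset.mul_sum, aux_sum_zero p hp, aux_swap p hp, aux_quarter p hp]
  ring
end
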